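/- Fix q ∈ (0,1/2) and a > 0 with a·c₀ ≥ 2. There exists a constant C > 0, independent of ε and n, such that for every ε ∈ (0,1] with aε < q and every integer n ≥ 2, the nonlinear discrete scheme on the Bakhvalov mesh has a unique solution y, and max_{0≤i≤n} |u(x_i) − y_i| ≤ C n^{−2}, where u is the solution of the continuous problem. -/

import Mathlib

open Set Real

noncomputable section

/-- first partial derivative of `f(x,u)` with respect to `u` -/
def pderiv1 (f : ℝ → ℝ → ℝ) (x y : ℝ) : ℝ := deriv (fun z => f x z) y

/-- second partial derivative of `f(x,u)` with respect to `u` -/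
def pderiv2 (f : ℝ → ℝ → ℝ) (x y : ℝ) : ℝ :=
  deriv (fun z => deriv (fun w => f x w) z) y

/-- `f` is four times continuously differentiable on `[0,1] × ℝ`. -/
def SmoothF (f : ℝ → ℝ → ℝ) : Prop :=
  ContDiffOn ℝ 4 (fun p : ℝ × ℝ => f p.1 p.2) ((Icc (0:ℝ) 1) ×ˢ (univ : Set ℝ))

/-- the stability condition `f_u(x,u) ≥ c₀² > 0` on `[0,1] × ℝ` -/
def LowerF (f : ℝ → ℝ → ℝ) (c₀ : ℝ) : Prop :=
  ∀ x ∈ Icc (0:ℝ) 1, ∀ y : ℝ, c₀ ^ 2 ≤ pderiv1 f x y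

/-- `u` is a C⁴-solution of the semilinear BVP `-ε²u'' + f(x,u) = 0`, `u(0)=u(1)=0`. -/
def IsSolution (f : ℝ → ℝ → ℝ) (ε : ℝ) (u : ℝ → ℝ) : Prop :=
  ContDiffOn ℝ 4 u (Icc (0:ℝ) 1) ∧
  (∀ x ∈ Ioo (0:ℝ) 1,
    -ε ^ 2 * iteratedDerivWithin 2 u (Icc (0:ℝ) 1) x + f x (u x) = 0) ∧
  u 0 = 0 ∧ u 1 = 0

/-- the constant `l = c₀⁻² · max_{[0,1]} |f(x,0)|` -/
def lconst (f : ℝ → ℝ → ℝ) (c₀ : ℝ) : ℝ :=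
  c₀ ^ (-2 : ℤ) * sSup ((fun x => |f x 0|) '' Icc (0:ℝ) 1)

/-- the constant `θ = max { |f_uu(x,ξ)| : x ∈ [0,1], |ξ| ≤ l + 2ρ }` -/
def thconst (f : ℝ → ℝ → ℝ) (c₀ ρ : ℝ) : ℝ :=
  sSup ((fun p : ℝ × ℝ => |pderiv2 f p.1 p.2|) ''
    ((Icc (0:ℝ) 1) ×ˢ (Icc (-(lconst f c₀ + 2*ρ)) (lconst f c₀ + 2*ρ))))

/-- discrete second difference `y_{x̄x̂,i}` on a nonuniform mesh `x` (for `1 ≤ i`),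
using `ℏ_i = (h_i + h_{i+1})/2 = (x_{i+1} - x_{i-1})/2`. -/
def ddiff (x y : ℕ → ℝ) (i : ℕ) : ℝ :=
  2 / (x (i+1) - x (i-1)) *
    ((y (i+1) - y i) / (x (i+1) - x i) - (y i - y (i-1)) / (x i - x (i-1)))

/-- Shishkin mesh generating function with transition parameter
`α = min(1/4, 2γ₀⁻¹ ε ln n)`. -/
def shishkinLam (γ₀ ε : ℝ) (n : ℕ) (t : ℝ) : ℝ :=
  let α := min (1/4) (2 * γ₀⁻¹ * ε * Real.log n)
  if t ≤ 1/4 then 4*α*t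
  else if t ≤ 1/2 then α + 2*(1-2*α)*(t-1/4)
  else 1 - (if 1-t ≤ 1/4 then 4*α*(1-t) else α + 2*(1-2*α)*((1-t)-1/4))

/-- Shishkin mesh nodes `x_i = λ(i/n)` -/
def shishkinMesh (γ₀ ε : ℝ) (n i : ℕ) : ℝ := shishkinLam γ₀ ε n ((i:ℝ)/(n:ℝ))

def bakhPhi (a ε q t : ℝ) : ℝ := a*ε*Real.log (q/(q-t))

/-- derivative of `bakhPhi` -/
def bakhPhi' (a ε q t : ℝ) : ℝ := a*ε/(q-t)

/-- `α ∈ (0,q)` is the abscissa of the contact point of the tangent line from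
`(1/2,1/2)` to `φ`, i.e. `φ(α) + φ'(α)(1/2 - α) = 1/2`. -/
def IsBakhAlpha (a ε q α : ℝ) : Prop :=
  α ∈ Ioo 0 q ∧ bakhPhi a ε q α + bakhPhi' a ε q α * (1/2 - α) = 1/2

/-- Bakhvalov mesh generating function -/
def bakhLam (a ε q α t : ℝ) : ℝ :=
  if t ≤ α then bakhPhi a ε q t
  else if t ≤ 1/2 then bakhPhi a ε q α + bakhPhi' a ε q α * (t-α)
  else 1 - (if 1-t ≤ α then bakhPhi a ε q (1-t)
            else bakhPhi a ε q α + bakhPhi' a ε q α * ((1-t)-α))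

/-- Bakhvalov mesh nodes `x_i = λ(i/n)` -/
def bakhMesh (a ε q α : ℝ) (n i : ℕ) : ℝ := bakhLam a ε q α ((i:ℝ)/(n:ℝ))

def vulAlpha (a ε q : ℝ) : ℝ :=
  (q - Real.sqrt (ε*a*q*(1-2*q+2*ε*a)))/(1+2*ε*a)

def vulMu (a ε q t : ℝ) : ℝ := a*ε*t/(q-t)

/-- derivative of `vulMu` -/
def vulMu' (a ε q t : ℝ) : ℝ := a*ε*q/(q-t)^2

/-- Vulanović mesh generating function -/
def vulLam (a ε q t : ℝ) : ℝ :=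
  let α := vulAlpha a ε q
  if t ≤ α then vulMu a ε q t
  else if t ≤ 1/2 then vulMu a ε q α + vulMu' a ε q α * (t-α)
  else 1 - (if 1-t ≤ α then vulMu a ε q (1-t)
            else vulMu a ε q α + vulMu' a ε q α * ((1-t)-α))

/-- Vulanović mesh nodes `x_i = λ(i/n)` -/
def vulMesh (a ε q : ℝ) (n i : ℕ) : ℝ := vulLam a ε q ((i:ℝ)/(n:ℝ))

/-- the three-point discrete scheme for the linear problem
`-ε² y_{x̄x̂,i} + b(x_i) y_i = g(x_i)`, `y_0 = y_n = 0` -/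
def LinScheme (bc gc : ℝ → ℝ) (ε : ℝ) (x : ℕ → ℝ) (n : ℕ) (y : ℕ → ℝ) : Prop :=
  (∀ i : ℕ, 1 ≤ i → i < n →
    -ε ^ 2 * ddiff x y i + bc (x i) * y i = gc (x i)) ∧
  y 0 = 0 ∧ y n = 0

/-- the nonlinear discrete scheme `-ε² y_{x̄x̂,i} + f(x_i, y_i) = 0`, `y_0 = y_n = 0` -/
def NonlinScheme (f : ℝ → ℝ → ℝ) (ε : ℝ) (x : ℕ → ℝ) (n : ℕ) (y : ℕ → ℝ) : Prop :=
  (∀ i : ℕ, 1 ≤ i → i < n → -ε ^ 2 * ddiff x y i + f (x i) (y i) = 0) ∧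
  y 0 = 0 ∧ y n = 0

/-- `u` is a C²-solution of the continuous linear problem
`-ε²u'' + b(x)u = g(x)`, `u(0)=u(1)=0`. -/
def IsLinSolution (bc gc : ℝ → ℝ) (ε : ℝ) (u : ℝ → ℝ) : Prop :=
  ContDiffOn ℝ 2 u (Icc (0:ℝ) 1) ∧
  (∀ x ∈ Ioo (0:ℝ) 1,
    -ε ^ 2 * iteratedDerivWithin 2 u (Icc (0:ℝ) 1) x + bc x * u x = gc x) ∧
  u 0 = 0 ∧ u 1 = 0

/-- `b(x,ε)` is three times continuously differentiable in `x` on `[0,1]`,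
with these derivatives bounded uniformly in `ε ∈ [0,1]`. -/
def UnifC3 (b : ℝ → ℝ → ℝ) : Prop :=
  ∃ M : ℝ, ∀ ε ∈ Icc (0:ℝ) 1,
    ContDiffOn ℝ 3 (fun x => b x ε) (Icc (0:ℝ) 1) ∧
    ∀ j : ℕ, j ≤ 3 → ∀ x ∈ Icc (0:ℝ) 1,
      |iteratedDerivWithin j (fun x => b x ε) (Icc (0:ℝ) 1) x| ≤ M

/-- `w` is the continuous piecewise-linear interpolant of mesh data `y`
on the mesh `x_0 < … < x_n`. -/
def IsLinInterp (x : ℕ → ℝ) (n : ℕ) (y : ℕ → ℝ) (w : ℝ → ℝ) : Prop :=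
  (∀ i ≤ n, w (x i) = y i) ∧
  ∀ i < n, ∀ t ∈ Icc (x i) (x (i+1)),
    w t = y i + (y (i+1) - y i) * (t - x i) / (x (i+1) - x i)

/-- properties of the initial guess `u⁰`: of class C³, within `ρ` of the
solution `u`, and satisfying ε-uniform bounds of layer type for `j = 0, 1`. -/
def InitGuess (c₀ ε C₀ ρ : ℝ) (u u0 : ℝ → ℝ) : Prop :=
  ContDiffOn ℝ 3 u0 (Icc (0:ℝ) 1) ∧
  (∀ x ∈ Icc (0:ℝ) 1, |u0 x - u x| ≤ ρ) ∧
  (∀ x ∈ Icc (0:ℝ) 1, |u0 x| ≤ C₀) ∧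
  (∀ x ∈ Icc (0:ℝ) 1, |derivWithin u0 (Icc (0:ℝ) 1) x| ≤
    C₀ * (1 + ε⁻¹ * (Real.exp (-c₀*x/ε) + Real.exp (-c₀*(1-x)/ε))))

/-- the discrete Newton (quasilinearization) iterates on the mesh `x`:
`y⁰_i = u⁰(x_i)` and `y^{m+1}` solves the quasilinearized discrete problem. -/
def NewtonIter (f : ℝ → ℝ → ℝ) (ε : ℝ) (x : ℕ → ℝ) (n : ℕ) (u0 : ℝ → ℝ)
    (Y : ℕ → ℕ → ℝ) : Prop :=
  (∀ i ≤ n, Y 0 i = u0 (x i)) ∧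
  ∀ m : ℕ,
    (∀ i : ℕ, 1 ≤ i → i < n →
      -ε ^ 2 * ddiff x (Y (m+1)) i + pderiv1 f (x i) (Y m i) * Y (m+1) i
        = -f (x i) (Y m i) + pderiv1 f (x i) (Y m i) * Y m i) ∧
    Y (m+1) 0 = 0 ∧ Y (m+1) n = 0

/-! ### Calculus lemmas -/

lemma aux_step {r r' : ℝ → ℝ} {x b M : ℝ} {k : ℕ} (hc : ContinuousOn r (Icc x b))
    (hd : ∀ t ∈ Ico x b, HasDerivAt r (r' t) t) (h0 : r x = 0)
    (hb : ∀ t ∈ Ico x b, |r' t| ≤ M * (t - x) ^ k) :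
    ∀ t ∈ Icc x b, |r t| ≤ M / (k + 1) * (t - x) ^ (k + 1) := by
  intro t ht
  have hk : ((k : ℝ) + 1) ≠ 0 := by positivity
  have := image_norm_le_of_norm_deriv_right_le_deriv_boundary (f := r) (f' := r') (a := x) (b := b)
    (B := fun t => M / (k + 1) * (t - x) ^ (k + 1)) (B' := fun t => M * (t - x) ^ k) hc
    (fun t ht => (hd t ht).hasDerivWithinAt) (by simp [h0])
    (fun t => by
      have h1 : HasDerivAt (fun t : ℝ => (t - x) ^ (k + 1)) (((k + 1 : ℕ) : ℝ) * (t - x) ^ k * 1) t := by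
        exact (((hasDerivAt_id' t).sub_const x).fun_pow (k + 1)).congr_deriv (by simp)
      have h2 := h1.const_mul (M / (k + 1))
      exact h2.congr_deriv (by push_cast; field_simp))
    (fun t ht => by simpa using hb t ht)
  simpa using this ht

lemma aux_taylor2 {u u1 u2 : ℝ → ℝ} {x b M : ℝ} (hxb : x < b) (hc : ContinuousOn u (Icc x b))
    (h1 : ∀ t ∈ Ico x b, HasDerivAt u (u1 t) t)
    (h2 : ∀ t ∈ Ico x b, HasDerivAt u1 (u2 t) t)
    (hb : ∀ t ∈ Ico x b, |u2 t| ≤ M) :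
    |u b - u x - u1 x * (b - x)| ≤ M / 2 * (b - x) ^ 2 := by
  have s1 : ∀ t ∈ Ico x b, |u1 t - u1 x| ≤ M * (t - x) ^ 1 := by
    intro t ht
    have := aux_step (r := fun t => u1 t - u1 x) (r' := u2) (x := x) (b := t) (M := M) (k := 0)
      (fun s hs => ((h2 s ⟨hs.1, hs.2.trans_lt ht.2⟩).sub_const _).continuousAt.continuousWithinAt)
      (fun s hs => (h2 s ⟨hs.1, hs.2.trans ht.2⟩).sub_const _) (by simp)
      (fun s hs => by simpa using hb s ⟨hs.1, hs.2.trans ht.2⟩) t ⟨ht.1, le_rfl⟩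
    simpa using this
  have := aux_step (r := fun t => u t - u x - u1 x * (t - x)) (r' := fun t => u1 t - u1 x)
      (x := x) (b := b) (M := M) (k := 1)
      (by fun_prop) (fun s hs => by
        have := ((h1 s hs).sub_const (u x)).fun_sub (((hasDerivAt_id' s).sub_const x).const_mul (u1 x))
        exact this.congr_deriv (by simp)) (by simp) s1 b ⟨hxb.le, le_rfl⟩
  convert this using 2
  norm_num

lemma aux_taylor4 {u u1 u2 u3 u4 : ℝ → ℝ} {x b M : ℝ} (hxb : x < b) (hc : ContinuousOn u (Icc x b))
    (h1 : ∀ t ∈ Ico x b, HasDerivAt u (u1 t) t)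
    (h2 : ∀ t ∈ Ico x b, HasDerivAt u1 (u2 t) t)
    (h3 : ∀ t ∈ Ico x b, HasDerivAt u2 (u3 t) t)
    (h4 : ∀ t ∈ Ico x b, HasDerivAt u3 (u4 t) t)
    (hb : ∀ t ∈ Ico x b, |u4 t| ≤ M) :
    |u b - u x - u1 x * (b - x) - u2 x / 2 * (b - x) ^ 2 - u3 x / 6 * (b - x) ^ 3|
      ≤ M / 24 * (b - x) ^ 4 := by
  have s2 : ∀ t ∈ Ico x b, |u2 t - u2 x - u3 x * (t - x)| ≤ M / 2 * (t - x) ^ 2 := by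
    intro t ht
    rcases ht.1.eq_or_lt with rfl | hlt
    · simp
    exact aux_taylor2 hlt
      (fun s hs => (h3 s ⟨hs.1, hs.2.trans_lt ht.2⟩).continuousAt.continuousWithinAt)
      (fun s hs => h3 s ⟨hs.1, hs.2.trans ht.2⟩) (fun s hs => h4 s ⟨hs.1, hs.2.trans ht.2⟩)
      (fun s hs => hb s ⟨hs.1, hs.2.trans ht.2⟩)
  have d1 : ∀ s c : ℝ, HasDerivAt (fun t : ℝ => c * (t - x)) c s := fun s c => by
    simpa using ((hasDerivAt_id s).sub_const x).const_mul c
  have d2 : ∀ s c : ℝ, HasDerivAt (fun t : ℝ => c / 2 * (t - x) ^ 2) (c * (s - x)) s := fun s c => by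
    have := (((hasDerivAt_id' s).sub_const x).fun_pow 2).const_mul (c / 2)
    exact this.congr_deriv (by push_cast; ring)
  have d3 : ∀ s c : ℝ, HasDerivAt (fun t : ℝ => c / 6 * (t - x) ^ 3) (c / 2 * (s - x) ^ 2) s :=
    fun s c => by
    have := (((hasDerivAt_id' s).sub_const x).fun_pow 3).const_mul (c / 6)
    exact this.congr_deriv (by push_cast; ring)
  have e1 : ∀ s ∈ Ico x b, HasDerivAt (fun t => u1 t - u1 x - u2 x * (t - x) - u3 x / 2 * (t - x) ^ 2)
      (u2 s - u2 x - u3 x * (s - x)) s := fun s hs =>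
    (((h2 s hs).sub_const _).sub (d1 s _)).sub (d2 s _)
  have s1 : ∀ t ∈ Ico x b, |u1 t - u1 x - u2 x * (t - x) - u3 x / 2 * (t - x) ^ 2|
      ≤ M / 6 * (t - x) ^ 3 := by
    intro t ht
    have := aux_step (x := x) (b := t) (M := M / 2) (k := 2)
      (fun s hs => (e1 s ⟨hs.1, hs.2.trans_lt ht.2⟩).continuousAt.continuousWithinAt)
      (fun s hs => e1 s ⟨hs.1, hs.2.trans ht.2⟩) (by simp)
      (fun s hs => s2 s ⟨hs.1, hs.2.trans ht.2⟩) t ⟨ht.1, le_rfl⟩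
    convert this using 2
    push_cast; ring
  have := aux_step
      (r := fun t => u t - u x - u1 x * (t - x) - u2 x / 2 * (t - x) ^ 2 - u3 x / 6 * (t - x) ^ 3)
      (r' := fun t => u1 t - u1 x - u2 x * (t - x) - u3 x / 2 * (t - x) ^ 2)
      (x := x) (b := b) (M := M / 6) (k := 3)
      (by fun_prop) (fun s hs => (((((h1 s hs).sub_const _).sub (d1 s _)).sub (d2 s _)).sub (d3 s _)))
      (by simp) s1 b ⟨hxb.le, le_rfl⟩
  convert this using 2
  push_cast; ring

/-- `u` on `[0,1]` with derivatives `u1,u2,u3,u4` in the open interval. -/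
structure Chain4 (u u1 u2 u3 u4 : ℝ → ℝ) : Prop where
  cont : ContinuousOn u (Icc (0:ℝ) 1)
  d1 : ∀ x ∈ Ioo (0:ℝ) 1, HasDerivAt u (u1 x) x
  d2 : ∀ x ∈ Ioo (0:ℝ) 1, HasDerivAt u1 (u2 x) x
  d3 : ∀ x ∈ Ioo (0:ℝ) 1, HasDerivAt u2 (u3 x) x
  d4 : ∀ x ∈ Ioo (0:ℝ) 1, HasDerivAt u3 (u4 x) x

lemma Chain4.reflect {u u1 u2 u3 u4 : ℝ → ℝ} (h : Chain4 u u1 u2 u3 u4) :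
    Chain4 (fun t => u (1 - t)) (fun t => -u1 (1 - t)) (fun t => u2 (1 - t))
      (fun t => -u3 (1 - t)) (fun t => u4 (1 - t)) := by
  have m : ∀ x ∈ Ioo (0:ℝ) 1, 1 - x ∈ Ioo (0:ℝ) 1 := fun x hx => ⟨by linarith [hx.2], by linarith [hx.1]⟩
  refine ⟨h.cont.comp (by fun_prop) (fun x hx => ⟨by linarith [hx.2], by linarith [hx.1]⟩), ?_, ?_, ?_, ?_⟩
  · intro x hx; exact (h.d1 _ (m x hx)).comp_const_sub 1 x
  · intro x hx; simpa using ((h.d2 _ (m x hx)).comp_const_sub 1 x).fun_neg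
  · intro x hx; exact (h.d3 _ (m x hx)).comp_const_sub 1 x
  · intro x hx; simpa using ((h.d4 _ (m x hx)).comp_const_sub 1 x).fun_neg

lemma Chain4.right2 {u u1 u2 u3 u4 : ℝ → ℝ} (h : Chain4 u u1 u2 u3 u4) {x b M : ℝ}
    (hx : 0 < x) (hxb : x < b) (hb : b ≤ 1) (hM : ∀ t ∈ Ico x b, |u2 t| ≤ M) :
    |u b - u x - u1 x * (b - x)| ≤ M / 2 * (b - x) ^ 2 :=
  aux_taylor2 hxb (h.cont.mono (Icc_subset_Icc hx.le hb))
    (fun t ht => h.d1 t ⟨hx.trans_le ht.1, ht.2.trans_le hb⟩)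
    (fun t ht => h.d2 t ⟨hx.trans_le ht.1, ht.2.trans_le hb⟩) hM

lemma Chain4.right4 {u u1 u2 u3 u4 : ℝ → ℝ} (h : Chain4 u u1 u2 u3 u4) {x b M : ℝ}
    (hx : 0 < x) (hxb : x < b) (hb : b ≤ 1) (hM : ∀ t ∈ Ico x b, |u4 t| ≤ M) :
    |u b - u x - u1 x * (b - x) - u2 x / 2 * (b - x) ^ 2 - u3 x / 6 * (b - x) ^ 3|
      ≤ M / 24 * (b - x) ^ 4 :=
  aux_taylor4 hxb (h.cont.mono (Icc_subset_Icc hx.le hb))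
    (fun t ht => h.d1 t ⟨hx.trans_le ht.1, ht.2.trans_le hb⟩)
    (fun t ht => h.d2 t ⟨hx.trans_le ht.1, ht.2.trans_le hb⟩)
    (fun t ht => h.d3 t ⟨hx.trans_le ht.1, ht.2.trans_le hb⟩)
    (fun t ht => h.d4 t ⟨hx.trans_le ht.1, ht.2.trans_le hb⟩) hM

lemma Chain4.left2 {u u1 u2 u3 u4 : ℝ → ℝ} (h : Chain4 u u1 u2 u3 u4) {x b M : ℝ}
    (hx : x < 1) (hxb : b < x) (hb : 0 ≤ b) (hM : ∀ t ∈ Ioc b x, |u2 t| ≤ M) :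
    |u b - u x + u1 x * (x - b)| ≤ M / 2 * (x - b) ^ 2 := by
  have := h.reflect.right2 (x := 1 - x) (b := 1 - b) (M := M) (by linarith) (by linarith) (by linarith)
    (fun t ht => hM _ ⟨by linarith [ht.2], by linarith [ht.1]⟩)
  simp only [sub_sub_cancel] at this
  convert this using 2 <;> ring

lemma Chain4.left4 {u u1 u2 u3 u4 : ℝ → ℝ} (h : Chain4 u u1 u2 u3 u4) {x b M : ℝ}
    (hx : x < 1) (hxb : b < x) (hb : 0 ≤ b) (hM : ∀ t ∈ Ioc b x, |u4 t| ≤ M) :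
    |u b - u x + u1 x * (x - b) - u2 x / 2 * (x - b) ^ 2 + u3 x / 6 * (x - b) ^ 3|
      ≤ M / 24 * (x - b) ^ 4 := by
  have := h.reflect.right4 (x := 1 - x) (b := 1 - b) (M := M) (by linarith) (by linarith) (by linarith)
    (fun t ht => hM _ ⟨by linarith [ht.2], by linarith [ht.1]⟩)
  simp only [sub_sub_cancel] at this
  convert this using 2 <;> ring

/-- three point second difference -/
def dd3 (p x r up ux ur : ℝ) : ℝ := 2 / (r - p) * ((ur - ux) / (r - x) - (ux - up) / (x - p))

lemma Chain4.dd_le {u u1 u2 u3 u4 : ℝ → ℝ} (h : Chain4 u u1 u2 u3 u4) {p x r M : ℝ}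
    (hp : 0 ≤ p) (hpx : p < x) (hxr : x < r) (hr : r ≤ 1) (hM : ∀ t ∈ Ioo p r, |u2 t| ≤ M) :
    |dd3 p x r (u p) (u x) (u r) - u2 x| ≤ 2 * M := by
  have a1 := h.right2 (x := x) (b := r) (M := M) (by linarith) hxr hr
    (fun t ht => hM t ⟨by linarith [ht.1], ht.2⟩)
  have a2 := h.left2 (x := x) (b := p) (M := M) (by linarith) hpx hp
    (fun t ht => hM t ⟨ht.1, by linarith [ht.2]⟩)
  have a3 := hM x ⟨hpx, hxr⟩
  obtain ⟨H, hH⟩ : ∃ H, H = x - p := ⟨_, rfl⟩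
  obtain ⟨K, hK⟩ : ∃ K, K = r - x := ⟨_, rfl⟩
  have hH0 : 0 < H := by linarith
  have hK0 : 0 < K := by linarith
  have e : r - p = H + K := by linarith
  rw [← hH] at a2
  rw [← hK] at a1
  unfold dd3
  rw [e, ← hH, ← hK]
  obtain ⟨A, hA⟩ : ∃ A, A = u r - u x - u1 x * K := ⟨_, rfl⟩
  obtain ⟨B, hB⟩ : ∃ B, B = u p - u x + u1 x * H := ⟨_, rfl⟩
  rw [← hA] at a1
  rw [← hB] at a2
  have key : 2 / (H + K) * ((u r - u x) / K - (u x - u p) / H) = 2 / (H + K) * (A / K + B / H) := by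
    rw [hA, hB]; field_simp; ring
  have b1 : |A / K| ≤ M / 2 * K := by
    rw [abs_div, abs_of_pos hK0, div_le_iff₀ hK0]; linarith
  have b2 : |B / H| ≤ M / 2 * H := by
    rw [abs_div, abs_of_pos hH0, div_le_iff₀ hH0]; linarith
  have b3 : |2 / (H + K) * (A / K + B / H)| ≤ M := by
    rw [abs_mul, abs_of_pos (by positivity : 0 < 2 / (H + K)), div_mul_eq_mul_div,
      div_le_iff₀ (by positivity)]
    linarith [abs_add_le (A / K) (B / H)]
  rw [key]
  linarith [abs_sub (2 / (H + K) * (A / K + B / H)) (u2 x)]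

lemma Chain4.dd_le4 {u u1 u2 u3 u4 : ℝ → ℝ} (h : Chain4 u u1 u2 u3 u4) {p x r M : ℝ}
    (hp : 0 ≤ p) (hpx : p < x) (hxr : x < r) (hr : r ≤ 1) (hhk : x - p ≤ r - x)
    (hM : ∀ t ∈ Ioo p r, |u4 t| ≤ M) :
    |dd3 p x r (u p) (u x) (u r) - u2 x| ≤ ((r - x) - (x - p)) * |u3 x| + (r - x) ^ 2 * M := by
  have a1 := h.right4 (x := x) (b := r) (M := M) (by linarith) hxr hr
    (fun t ht => hM t ⟨by linarith [ht.1], ht.2⟩)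
  have a2 := h.left4 (x := x) (b := p) (M := M) (by linarith) hpx hp
    (fun t ht => hM t ⟨ht.1, by linarith [ht.2]⟩)
  have a3 : 0 ≤ M := (abs_nonneg _).trans (hM x ⟨hpx, hxr⟩)
  obtain ⟨H, hH⟩ : ∃ H, H = x - p := ⟨_, rfl⟩
  obtain ⟨K, hK⟩ : ∃ K, K = r - x := ⟨_, rfl⟩
  have hH0 : 0 < H := by linarith
  have hK0 : 0 < K := by linarith
  have hHK : H ≤ K := by linarith
  have e : r - p = H + K := by linarith
  rw [← hH] at a2
  rw [← hK] at a1
  unfold dd3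
  rw [e, ← hH, ← hK]
  obtain ⟨A, hA⟩ : ∃ A, A = u r - u x - u1 x * K - u2 x / 2 * K ^ 2 - u3 x / 6 * K ^ 3 := ⟨_, rfl⟩
  obtain ⟨B, hB⟩ : ∃ B, B = u p - u x + u1 x * H - u2 x / 2 * H ^ 2 + u3 x / 6 * H ^ 3 := ⟨_, rfl⟩
  rw [← hA] at a1
  rw [← hB] at a2
  have key : 2 / (H + K) * ((u r - u x) / K - (u x - u p) / H) - u2 x
      = 2 / (H + K) * (A / K + B / H) + (K - H) / 3 * u3 x := by
    rw [hA, hB]; field_simp; ring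
  have b1 : |A / K| ≤ M / 24 * K ^ 3 := by
    rw [abs_div, abs_of_pos hK0, div_le_iff₀ hK0]; linarith
  have b2 : |B / H| ≤ M / 24 * H ^ 3 := by
    rw [abs_div, abs_of_pos hH0, div_le_iff₀ hH0]; linarith
  have b3 : |2 / (H + K) * (A / K + B / H)| ≤ K ^ 2 * M := by
    rw [abs_mul, abs_of_pos (by positivity : 0 < 2 / (H + K)), div_mul_eq_mul_div,
      div_le_iff₀ (by positivity)]
    have : H ^ 3 ≤ K ^ 3 := by gcongr
    have h2 : M * H ^ 3 ≤ M * K ^ 3 := by gcongr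
    have h3 : 0 ≤ M * K ^ 3 := by positivity
    have h4 : 0 ≤ K ^ 2 * M * H := by positivity
    nlinarith [abs_add_le (A / K) (B / H)]
  rw [key]
  have b4 : |(K - H) / 3 * u3 x| ≤ (K - H) * |u3 x| := by
    rw [abs_mul, abs_of_nonneg (by linarith : 0 ≤ (K - H) / 3)]
    have := abs_nonneg (u3 x)
    gcongr
    linarith
  linarith [abs_add_le (2 / (H + K) * (A / K + B / H)) ((K - H) / 3 * u3 x)]

/-- second derivative test at a local maximum -/
lemma second_deriv_nonpos {z z1 : ℝ → ℝ} {z2 x : ℝ} (hm : IsLocalMax z x)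
    (h1 : ∀ᶠ t in nhds x, HasDerivAt z (z1 t) t) (h2 : HasDerivAt z1 z2 x) : z2 ≤ 0 := by
  by_contra hpos
  push Not at hpos
  have hd : deriv z =ᶠ[nhds x] z1 := h1.mono fun t ht => ht.deriv
  have hdd : deriv (deriv z) x = z2 := by rw [hd.deriv_eq]; exact h2.deriv
  have hmin : IsLocalMin z x := isLocalMin_of_deriv_deriv_pos (by rw [hdd]; exact hpos)
    hm.deriv_eq_zero h1.self_of_nhds.continuousAt
  have hconst : z =ᶠ[nhds x] fun _ => z x := by
    filter_upwards [hm, hmin] with t a b using le_antisymm a b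
  have : deriv z =ᶠ[nhds x] fun _ => 0 := by
    have := hconst.deriv
    simpa using this
  have h0 : deriv (deriv z) x = 0 := by rw [this.deriv_eq]; simp
  linarith
/-! ### Partial derivatives of `f` and the reduced solution -/

abbrev SS : Set (ℝ × ℝ) := (Icc (0:ℝ) 1) ×ˢ (univ : Set ℝ)

abbrev lin2 (a b : ℝ) : ℝ × ℝ →L[ℝ] ℝ :=
  a • ContinuousLinearMap.fst ℝ ℝ ℝ + b • ContinuousLinearMap.snd ℝ ℝ ℝ

lemma SS_uniqueDiffOn : UniqueDiffOn ℝ SS :=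
  (uniqueDiffOn_Icc (by norm_num)).prod uniqueDiffOn_univ

lemma SS_nhds {x y : ℝ} (hx : x ∈ Ioo (0:ℝ) 1) : SS ∈ nhds (x, y) :=
  prod_mem_nhds (Icc_mem_nhds hx.1 hx.2) Filter.univ_mem

lemma aux_partials (k : ℕ) {φ : ℝ × ℝ → ℝ} (h : ContDiffOn ℝ (k + 1 : ℕ) φ SS) :
    ∃ φx φu : ℝ × ℝ → ℝ, ContDiffOn ℝ k φx SS ∧ ContDiffOn ℝ k φu SS ∧
      ∀ x ∈ Ioo (0:ℝ) 1, ∀ y, HasFDerivAt φ (lin2 (φx (x, y)) (φu (x, y))) (x, y) := by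
  have hG : ContDiffOn ℝ k (fderivWithin ℝ φ SS) SS :=
    h.fderivWithin SS_uniqueDiffOn (by norm_cast)
  refine ⟨fun p => fderivWithin ℝ φ SS p (1, 0), fun p => fderivWithin ℝ φ SS p (0, 1),
    hG.clm_apply contDiffOn_const, hG.clm_apply contDiffOn_const, ?_⟩
  intro x hx y
  have hd : DifferentiableAt ℝ φ (x, y) :=
    (h.contDiffAt (SS_nhds hx)).differentiableAt (by norm_cast)
  have e : fderivWithin ℝ φ SS (x, y) = fderiv ℝ φ (x, y) := fderivWithin_of_mem_nhds (SS_nhds hx)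
  have := hd.hasFDerivAt
  convert this using 1
  simp only [e]
  ext <;> simp

lemma HasFDerivAt.comp_graph {φ : ℝ × ℝ → ℝ} {A B x v' : ℝ} {v : ℝ → ℝ}
    (h : HasFDerivAt φ (lin2 A B) (x, v x)) (hv : HasDerivAt v v' x) :
    HasDerivAt (fun t => φ (t, v t)) (A + B * v') x := by
  have h1 : HasDerivAt (fun t => (t, v t)) ((1:ℝ), v') x := (hasDerivAt_id' x).prodMk hv
  exact (h.comp_hasDerivAt x h1).congr_deriv (by simp)

structure FD (f : ℝ → ℝ → ℝ) (c₀ : ℝ) (fx fu fxx fxu fux fuu : ℝ × ℝ → ℝ) : Prop where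
  hc : 0 < c₀
  slope : ∀ x ∈ Icc (0:ℝ) 1, ∀ y y', y ≤ y' → c₀ ^ 2 * (y' - y) ≤ f x y' - f x y
  contu : ∀ x ∈ Icc (0:ℝ) 1, Continuous (f x)
  cf : ContinuousOn (fun p : ℝ × ℝ => f p.1 p.2) SS
  cx : ContinuousOn fx SS
  cu : ContinuousOn fu SS
  cxx : ContinuousOn fxx SS
  cxu : ContinuousOn fxu SS
  cux : ContinuousOn fux SS
  cuu : ContinuousOn fuu SS
  lower : ∀ x ∈ Ioo (0:ℝ) 1, ∀ y, c₀ ^ 2 ≤ fu (x, y)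
  df : ∀ x ∈ Ioo (0:ℝ) 1, ∀ y,
    HasFDerivAt (fun p : ℝ × ℝ => f p.1 p.2) (lin2 (fx (x, y)) (fu (x, y))) (x, y)
  dfx : ∀ x ∈ Ioo (0:ℝ) 1, ∀ y, HasFDerivAt fx (lin2 (fxx (x, y)) (fxu (x, y))) (x, y)
  dfu : ∀ x ∈ Ioo (0:ℝ) 1, ∀ y, HasFDerivAt fu (lin2 (fux (x, y)) (fuu (x, y))) (x, y)

lemma FD.exists {f : ℝ → ℝ → ℝ} {c₀ : ℝ} (hc₀ : 0 < c₀) (hf : SmoothF f) (hfu : LowerF f c₀) :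
    ∃ fx fu fxx fxu fux fuu, FD f c₀ fx fu fxx fxu fux fuu := by
  have hf' : ContDiffOn ℝ ((3 + 1 : ℕ)) (fun p : ℝ × ℝ => f p.1 p.2) SS := by
    norm_num; exact hf
  obtain ⟨fx, fu, hx, hu, hd⟩ := aux_partials 3 hf'
  obtain ⟨fxx, fxu, hxx, hxu, hdx⟩ := aux_partials 2 hx
  obtain ⟨fux, fuu, hux, huu, hdu⟩ := aux_partials 2 hu
  have diff : ∀ x ∈ Icc (0:ℝ) 1, Differentiable ℝ (f x) := by
    intro x hx
    have h1 : ContDiffOn ℝ 4 (fun y : ℝ => f x y) univ :=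
      hf.comp (g := fun p : ℝ × ℝ => f p.1 p.2) (f := fun y : ℝ => (x, y))
        (contDiff_const.prodMk contDiff_id).contDiffOn (fun y _ => ⟨hx, mem_univ _⟩)
    exact (contDiffOn_univ.1 h1).differentiable (by norm_num)
  refine ⟨fx, fu, fxx, fxu, fux, fuu, hc₀, ?_, fun x hx => (diff x hx).continuous, hf.continuousOn,
    hx.continuousOn, hu.continuousOn, hxx.continuousOn, hxu.continuousOn, hux.continuousOn,
    huu.continuousOn, ?_, hd, hdx, hdu⟩
  · intro x hx y y' hy
    exact mul_sub_le_image_sub_of_le_deriv (diff x hx) (fun y => hfu x hx y) hy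
  · intro x hx y
    have h1 := hfu x ⟨hx.1.le, hx.2.le⟩ y
    have h2 : HasDerivAt (fun t : ℝ => (x, t)) ((0:ℝ), (1:ℝ)) y :=
      (hasDerivAt_const y x).prodMk (hasDerivAt_id' y)
    have h3 : HasDerivAt (f x) (fu (x, y)) y :=
      ((hd x hx y).comp_hasDerivAt y h2).congr_deriv (by simp)
    have h4 : pderiv1 f x y = fu (x, y) := h3.deriv
    rwa [h4] at h1

lemma SS_bdd {φ : ℝ × ℝ → ℝ} (h : ContinuousOn φ SS) (R : ℝ) :
    ∃ M : ℝ, 0 < M ∧ ∀ x ∈ Icc (0:ℝ) 1, ∀ y, |y| ≤ R → |φ (x, y)| ≤ M := by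
  have hK : IsCompact ((Icc (0:ℝ) 1) ×ˢ (Icc (-R) R)) := isCompact_Icc.prod isCompact_Icc
  obtain ⟨M, hM⟩ := hK.exists_bound_of_continuousOn
    (h.mono (prod_mono le_rfl (subset_univ _)))
  refine ⟨max M 1, by positivity, fun x hx y hy => le_max_of_le_left ?_⟩
  exact hM (x, y) ⟨hx, abs_le.1 hy⟩

section
variable {f : ℝ → ℝ → ℝ} {c₀ : ℝ} {fx fu fxx fxu fux fuu : ℝ × ℝ → ℝ}

lemma FD.slope_abs (h : FD f c₀ fx fu fxx fxu fux fuu) {x : ℝ} (hx : x ∈ Icc (0:ℝ) 1) (y y' : ℝ) :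
    c₀ ^ 2 * |y - y'| ≤ |f x y - f x y'| := by
  rcases le_total y y' with hy | hy
  · have := h.slope x hx y y' hy
    rw [abs_sub_comm, abs_sub_comm (f x y), abs_of_nonneg (by linarith : 0 ≤ y' - y)]
    exact this.trans (le_abs_self _)
  · have := h.slope x hx y' y hy
    rw [abs_of_nonneg (by linarith : 0 ≤ y - y')]
    exact this.trans (le_abs_self _)

lemma FD.root (h : FD f c₀ fx fu fxx fxu fux fuu) {x : ℝ} (hx : x ∈ Icc (0:ℝ) 1) :
    ∃ w, f x w = 0 := by
  have hc2 : 0 < c₀ ^ 2 := pow_pos h.hc 2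
  obtain ⟨Y, hY⟩ : ∃ Y, Y = |f x 0| / c₀ ^ 2 := ⟨_, rfl⟩
  have hY0 : 0 ≤ Y := by rw [hY]; positivity
  have hYe : c₀ ^ 2 * Y = |f x 0| := by rw [hY, mul_div_assoc', mul_div_cancel_left₀ _ hc2.ne']
  have h1 := h.slope x hx 0 Y hY0
  have h2 := h.slope x hx (-Y) 0 (by linarith)
  have h3 := neg_abs_le (f x 0)
  have h4 := le_abs_self (f x 0)
  have := intermediate_value_Icc (by linarith : -Y ≤ Y) (h.contu x hx).continuousOn
  obtain ⟨w, _, hw⟩ := this (show (0:ℝ) ∈ Icc (f x (-Y)) (f x Y) from ⟨by nlinarith, by nlinarith⟩)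
  exact ⟨w, hw⟩

lemma FD.reduced (h : FD f c₀ fx fu fxx fxu fux fuu) :
    ∃ w w1 w2 : ℝ → ℝ, ∃ W : ℝ, 0 < W ∧ (∀ x ∈ Icc (0:ℝ) 1, f x (w x) = 0) ∧
      ContinuousOn w (Icc 0 1) ∧ (∀ x ∈ Ioo (0:ℝ) 1, HasDerivAt w (w1 x) x) ∧
      (∀ x ∈ Ioo (0:ℝ) 1, HasDerivAt w1 (w2 x) x) ∧ (∀ x ∈ Icc (0:ℝ) 1, |w x| ≤ W) ∧
      (∀ x ∈ Ioo (0:ℝ) 1, |w1 x| ≤ W) ∧ (∀ x ∈ Ioo (0:ℝ) 1, |w2 x| ≤ W) := by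
  have hc2 : 0 < c₀ ^ 2 := pow_pos h.hc 2
  have hex : ∀ x : ℝ, ∃ w, x ∈ Icc (0:ℝ) 1 → f x w = 0 := fun x => by
    by_cases hx : x ∈ Icc (0:ℝ) 1
    · obtain ⟨w, hw⟩ := h.root hx; exact ⟨w, fun _ => hw⟩
    · exact ⟨0, fun h => absurd h hx⟩
  choose w hw using hex
  have hsec : ∀ x ∈ Icc (0:ℝ) 1, ∀ t ∈ Icc (0:ℝ) 1,
      |w t - w x| ≤ (c₀ ^ 2)⁻¹ * |f t (w x) - f x (w x)| := by
    intro x hx t ht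
    have := h.slope_abs ht (w t) (w x)
    rw [hw t ht] at this
    rw [hw x hx, inv_mul_eq_div, le_div_iff₀ hc2, sub_zero]
    rw [zero_sub, abs_neg] at this
    linarith
  have hcont : ContinuousOn w (Icc 0 1) := by
    intro x hx
    have c1 : ContinuousWithinAt (fun t => f t (w x)) (Icc 0 1) x :=
      (h.cf.comp (f := fun t : ℝ => (t, w x)) (by fun_prop) (fun t ht => ⟨ht, mem_univ _⟩)) x hx
    have c2 : Filter.Tendsto (fun t => (c₀ ^ 2)⁻¹ * |f t (w x) - f x (w x)|)
        (nhdsWithin x (Icc 0 1)) (nhds 0) := by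
      have := ((c1.sub_const (f x (w x))).abs).const_mul (c₀ ^ 2)⁻¹
      simpa using this
    rw [ContinuousWithinAt, tendsto_iff_norm_sub_tendsto_zero]
    refine squeeze_zero' (Filter.Eventually.of_forall fun t => norm_nonneg _) ?_ c2
    filter_upwards [self_mem_nhdsWithin] with t ht using hsec x hx t ht
  have hw1 : ∀ x ∈ Ioo (0:ℝ) 1, HasDerivAt w (-fx (x, w x) / fu (x, w x)) x := by
    intro x hx
    have hxI : x ∈ Icc (0:ℝ) 1 := ⟨hx.1.le, hx.2.le⟩
    have hfu0 : 0 < fu (x, w x) := hc2.trans_le (h.lower x hx _)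
    have hnhds : Icc (0:ℝ) 1 ∈ nhds x := Icc_mem_nhds hx.1 hx.2
    have hO : (fun t => w t - w x) =O[nhds x] fun t => t - x := by
      have h2 : HasDerivAt (fun t => f t (w x)) _ x :=
        HasFDerivAt.comp_graph (v := fun _ => w x) (h.df x hx (w x)) (hasDerivAt_const x (w x))
      have h3 : (fun t => f t (w x) - f x (w x)) =O[nhds x] fun t => t - x := h2.isBigO_sub
      refine Asymptotics.IsBigO.trans ?_ h3
      refine Asymptotics.IsBigO.of_bound (c₀ ^ 2)⁻¹ ?_
      filter_upwards [hnhds] with t ht using hsec x hxI t ht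
    have hcAt : ContinuousAt w x := hcont.continuousAt hnhds
    have hpair : Filter.Tendsto (fun t => (t, w t)) (nhds x) (nhds (x, w x)) :=
      (continuousAt_id.prodMk hcAt)
    have h4 := (h.df x hx (w x)).isLittleO.comp_tendsto hpair
    have h5 : (fun t => fx (x, w x) * (t - x) + fu (x, w x) * (w t - w x)) =o[nhds x]
        fun t => t - x := by
      have h6 : ((fun x' : ℝ × ℝ => x' - (x, w x)) ∘ fun t => (t, w t)) =O[nhds x]
          fun t => t - x := by
        have : ((fun x' : ℝ × ℝ => x' - (x, w x)) ∘ fun t => (t, w t))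
          = fun t => (t - x, w t - w x) := by ext t <;> simp
        rw [this]
        exact (Asymptotics.isBigO_refl _ _).prod_left hO
      refine ((h4.trans_isBigO h6).neg_left).congr' ?_ Filter.EventuallyEq.rfl
      filter_upwards [hnhds] with t ht
      simp [hw t ht, hw x hxI]
    rw [hasDerivAt_iff_isLittleO]
    refine (h5.const_mul_left (fu (x, w x))⁻¹).congr_left fun t => ?_
    simp only [smul_eq_mul]
    field_simp
    ring
  have hw2 : ∀ x ∈ Ioo (0:ℝ) 1, HasDerivAt (fun x => -fx (x, w x) / fu (x, w x))
      ((-(fxx (x, w x) + fxu (x, w x) * (-fx (x, w x) / fu (x, w x))) * fu (x, w x)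
        - (-fx (x, w x)) * (fux (x, w x) + fuu (x, w x) * (-fx (x, w x) / fu (x, w x))))
        / fu (x, w x) ^ 2) x := by
    intro x hx
    have hfu0 : 0 < fu (x, w x) := hc2.trans_le (h.lower x hx _)
    exact ((h.dfx x hx (w x)).comp_graph (hw1 x hx)).fun_neg.fun_div
      ((h.dfu x hx (w x)).comp_graph (hw1 x hx)) hfu0.ne'
  obtain ⟨M0, hM0, hM0'⟩ := SS_bdd h.cf 0
  obtain ⟨R, hR⟩ : ∃ R, R = (c₀ ^ 2)⁻¹ * M0 := ⟨_, rfl⟩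
  have hwR : ∀ x ∈ Icc (0:ℝ) 1, |w x| ≤ R := by
    intro x hx
    have := h.slope_abs hx (w x) 0
    rw [hw x hx] at this
    rw [hR, inv_mul_eq_div, le_div_iff₀ hc2]
    have h2 := hM0' x hx 0 (by simp)
    simp at this h2
    linarith
  obtain ⟨Ax, hAx, bx⟩ := SS_bdd h.cx R
  obtain ⟨Au, hAu, bu⟩ := SS_bdd h.cu R
  obtain ⟨Axx, hAxx, bxx⟩ := SS_bdd h.cxx R
  obtain ⟨Axu, hAxu, bxu⟩ := SS_bdd h.cxu R
  obtain ⟨Aux, hAux, bux⟩ := SS_bdd h.cux R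
  obtain ⟨Auu, hAuu, buu⟩ := SS_bdd h.cuu R
  have b1 : ∀ x ∈ Ioo (0:ℝ) 1, |-fx (x, w x) / fu (x, w x)| ≤ Ax / c₀ ^ 2 := by
    intro x hx
    have hxI : x ∈ Icc (0:ℝ) 1 := ⟨hx.1.le, hx.2.le⟩
    have hl := h.lower x hx (w x)
    have hfu0 : 0 < fu (x, w x) := hc2.trans_le hl
    rw [abs_div, abs_neg, abs_of_pos hfu0]
    have := bx x hxI _ (hwR x hxI)
    gcongr
  have b2 : ∀ x ∈ Ioo (0:ℝ) 1, |(-(fxx (x, w x) + fxu (x, w x) * (-fx (x, w x) / fu (x, w x))) * fu (x, w x)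
        - (-fx (x, w x)) * (fux (x, w x) + fuu (x, w x) * (-fx (x, w x) / fu (x, w x))))
        / fu (x, w x) ^ 2| ≤ ((Axx + Axu * (Ax / c₀ ^ 2)) * Au + Ax * (Aux + Auu * (Ax / c₀ ^ 2)))
          / (c₀ ^ 2) ^ 2 := by
    intro x hx
    have hxI : x ∈ Icc (0:ℝ) 1 := ⟨hx.1.le, hx.2.le⟩
    have hl := h.lower x hx (w x)
    have hfu0 : 0 < fu (x, w x) := hc2.trans_le hl
    have a1 := b1 x hx
    obtain ⟨v, hv⟩ : ∃ v, v = -fx (x, w x) / fu (x, w x) := ⟨_, rfl⟩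
    rw [← hv] at a1 ⊢
    have c1 := bx x hxI _ (hwR x hxI)
    have c2 := bu x hxI _ (hwR x hxI)
    have c3 := bxx x hxI _ (hwR x hxI)
    have c4 := bxu x hxI _ (hwR x hxI)
    have c5 := bux x hxI _ (hwR x hxI)
    have c6 := buu x hxI _ (hwR x hxI)
    rw [abs_div, abs_of_pos (by positivity : 0 < fu (x, w x) ^ 2)]
    gcongr
    refine (abs_sub _ _).trans ?_
    rw [abs_mul, abs_mul, abs_neg, abs_neg]
    have c7 : |fxx (x, w x) + fxu (x, w x) * v| ≤ Axx + Axu * (Ax / c₀ ^ 2) := by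
      refine (abs_add_le _ _).trans ?_
      rw [abs_mul]
      gcongr
    have c8 : |fux (x, w x) + fuu (x, w x) * v| ≤ Aux + Auu * (Ax / c₀ ^ 2) := by
      refine (abs_add_le _ _).trans ?_
      rw [abs_mul]
      gcongr
    gcongr
  refine ⟨w, _, _, max R (max (Ax / c₀ ^ 2) (((Axx + Axu * (Ax / c₀ ^ 2)) * Au + Ax * (Aux + Auu * (Ax / c₀ ^ 2)))
          / (c₀ ^ 2) ^ 2)), ?_, hw, hcont, hw1, hw2, ?_, ?_, ?_⟩
  · have : 0 < R := by rw [hR]; positivity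
    exact lt_max_of_lt_left this
  · intro x hx; exact le_max_of_le_left (hwR x hx)
  · intro x hx; exact le_max_of_le_right (le_max_of_le_left (b1 x hx))
  · intro x hx; exact le_max_of_le_right (le_max_of_le_right (b2 x hx))

end
/-! ### Layer function, interpolation inequality and derivative bounds -/

def EE (c₀ ε x : ℝ) : ℝ := Real.exp (-c₀ * x / ε) + Real.exp (-c₀ * (1 - x) / ε)

lemma EE_pos (c₀ ε x : ℝ) : 0 < EE c₀ ε x := by unfold EE; positivity

lemma EE_reflect (c₀ ε x : ℝ) : EE c₀ ε (1 - x) = EE c₀ ε x := by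
  unfold EE; rw [sub_sub_cancel, add_comm]

lemma EE_le_two {c₀ ε x : ℝ} (hc : 0 < c₀) (hε : 0 < ε) (hx : x ∈ Icc (0:ℝ) 1) : EE c₀ ε x ≤ 2 := by
  unfold EE
  have h1 : Real.exp (-c₀ * x / ε) ≤ 1 := by
    rw [Real.exp_le_one_iff]
    apply div_nonpos_of_nonpos_of_nonneg _ hε.le
    nlinarith [hx.1]
  have h2 : Real.exp (-c₀ * (1 - x) / ε) ≤ 1 := by
    rw [Real.exp_le_one_iff]
    apply div_nonpos_of_nonpos_of_nonneg _ hε.le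
    nlinarith [hx.2]
  linarith

lemma EE_zero_ge (c₀ ε : ℝ) : 1 ≤ EE c₀ ε 0 := by
  unfold EE
  have := Real.exp_pos (-c₀ * (1 - 0) / ε)
  simp at this ⊢
  positivity

lemma EE_one_ge (c₀ ε : ℝ) : 1 ≤ EE c₀ ε 1 := by
  have := EE_zero_ge c₀ ε
  rw [← EE_reflect] at this
  simpa using this

lemma EE_shift {c₀ ε x t : ℝ} (hc : 0 < c₀) (hε : 0 < ε) (h1 : x ≤ t) (h2 : t ≤ x + ε / 4) :
    EE c₀ ε t ≤ Real.exp (c₀ / 4) * EE c₀ ε x := by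
  unfold EE
  rw [mul_add, ← Real.exp_add, ← Real.exp_add]
  have e1 : ∀ s, c₀ / 4 + -c₀ * s / ε = (c₀ * ε / 4 + -c₀ * s) / ε := by intro s; field_simp
  rw [e1, e1]
  gcongr
  · nlinarith
  · nlinarith

def EE1 (c₀ ε x : ℝ) : ℝ := (c₀ / ε) * (-Real.exp (-c₀ * x / ε) + Real.exp (-c₀ * (1 - x) / ε))

lemma EE_hasDerivAt (c₀ ε x : ℝ) : HasDerivAt (EE c₀ ε) (EE1 c₀ ε x) x := by
  have h1 : HasDerivAt (fun x => -c₀ * x / ε) (-c₀ * 1 / ε) x :=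
    ((hasDerivAt_id' x).const_mul _).div_const _
  have h2 : HasDerivAt (fun x => -c₀ * (1 - x) / ε) (-c₀ * (-1) / ε) x :=
    (((hasDerivAt_id' x).const_sub 1).const_mul _).div_const _
  exact (h1.exp.fun_add h2.exp).congr_deriv (by unfold EE1; ring)

lemma EE1_hasDerivAt (c₀ ε x : ℝ) : HasDerivAt (EE1 c₀ ε) ((c₀ / ε) ^ 2 * EE c₀ ε x) x := by
  have h1 : HasDerivAt (fun x => -c₀ * x / ε) (-c₀ * 1 / ε) x :=
    ((hasDerivAt_id' x).const_mul _).div_const _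
  have h2 : HasDerivAt (fun x => -c₀ * (1 - x) / ε) (-c₀ * (-1) / ε) x :=
    (((hasDerivAt_id' x).const_sub 1).const_mul _).div_const _
  exact ((h1.exp.fun_neg.fun_add h2.exp).const_mul _).congr_deriv (by unfold EE; ring)

lemma interp_half {c₀ ε A : ℝ} (hc : 0 < c₀) (hε : 0 < ε) (hε1 : ε ≤ 1) (hA : 0 ≤ A)
    {φ φ1 φ2 : ℝ → ℝ} (d1 : ∀ x ∈ Ioo (0:ℝ) 1, HasDerivAt φ (φ1 x) x)
    (d2 : ∀ x ∈ Ioo (0:ℝ) 1, HasDerivAt φ1 (φ2 x) x)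
    (b0 : ∀ x ∈ Ioo (0:ℝ) 1, |φ x| ≤ A * (ε ^ 2 + EE c₀ ε x))
    (b2 : ∀ x ∈ Ioo (0:ℝ) 1, |φ2 x| ≤ A * (1 + (ε ^ 2)⁻¹ * EE c₀ ε x))
    {x : ℝ} (hx : 0 < x) (hx2 : x ≤ 1 / 2) :
    |φ1 x| ≤ 12 * Real.exp (c₀ / 4) * A * (ε + ε⁻¹ * EE c₀ ε x) := by
  obtain ⟨κ, hκ⟩ : ∃ κ, κ = Real.exp (c₀ / 4) := ⟨_, rfl⟩
  have hκ1 : 1 ≤ κ := by rw [hκ]; exact Real.one_le_exp (by positivity)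
  have hE := EE_pos c₀ ε x
  obtain ⟨e, he⟩ : ∃ e, e = EE c₀ ε x := ⟨_, rfl⟩
  have hI : ∀ t ∈ Icc x (x + ε / 4), t ∈ Ioo (0:ℝ) 1 := fun t ht =>
    ⟨by linarith [ht.1], by linarith [ht.2]⟩
  have hsh : ∀ t ∈ Icc x (x + ε / 4), EE c₀ ε t ≤ κ * e := fun t ht => by
    rw [hκ, he]; exact EE_shift hc hε ht.1 ht.2
  have T := aux_taylor2 (u := φ) (u1 := φ1) (u2 := φ2) (x := x) (b := x + ε / 4)
    (M := A * (1 + (ε ^ 2)⁻¹ * (κ * e))) (by linarith)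
    (fun t ht => (d1 t (hI t ht)).continuousAt.continuousWithinAt)
    (fun t ht => d1 t (hI t ⟨ht.1, ht.2.le⟩)) (fun t ht => d2 t (hI t ⟨ht.1, ht.2.le⟩))
    (fun t ht => by
      refine (b2 t (hI t ⟨ht.1, ht.2.le⟩)).trans ?_
      have := hsh t ⟨ht.1, ht.2.le⟩
      gcongr)
  rw [add_sub_cancel_left] at T
  have q0 := b0 x (hI x ⟨le_rfl, by linarith⟩)
  have q1 := b0 (x + ε / 4) (hI _ ⟨by linarith, le_rfl⟩)
  have q2 := hsh (x + ε / 4) ⟨by linarith, le_rfl⟩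
  have q3 : A * (ε ^ 2 + EE c₀ ε (x + ε / 4)) ≤ A * (ε ^ 2 + κ * e) := by gcongr
  rw [← he] at q0 hE
  rw [← hκ, ← he]
  have q4 : A * (1 + (ε ^ 2)⁻¹ * (κ * e)) / 2 * (ε / 4) ^ 2 = A * (ε ^ 2 + κ * e) / 32 := by
    field_simp; ring
  rw [q4] at T
  have q5 : A * (ε ^ 2 + e) ≤ κ * A * (ε ^ 2 + e) := by
    have : 0 ≤ A * (ε ^ 2 + e) := by positivity
    nlinarith
  have q6 : A * (ε ^ 2 + κ * e) ≤ κ * A * (ε ^ 2 + e) := by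
    have : 0 ≤ A * ε ^ 2 := by positivity
    nlinarith
  have q6' : 0 ≤ A * (ε ^ 2 + κ * e) := by positivity
  have q7 : |φ1 x * (ε / 4)| ≤ 3 * (κ * A * (ε ^ 2 + e)) := by
    have : φ1 x * (ε / 4) = φ (x + ε / 4) - φ x
      - (φ (x + ε / 4) - φ x - φ1 x * (ε / 4)) := by ring
    rw [this]
    linarith [abs_sub (φ (x + ε / 4) - φ x) (φ (x + ε / 4) - φ x - φ1 x * (ε / 4)),
      abs_sub (φ (x + ε / 4)) (φ x)]
  rw [abs_mul, abs_of_pos (by positivity : 0 < ε / 4)] at q7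
  have q8 : 12 * κ * A * (ε + ε⁻¹ * e) * (ε / 4) = 3 * (κ * A * (ε ^ 2 + e)) := by
    field_simp; ring
  rw [← q8] at q7
  exact le_of_mul_le_mul_right q7 (by positivity)

lemma interp {c₀ ε A : ℝ} (hc : 0 < c₀) (hε : 0 < ε) (hε1 : ε ≤ 1) (hA : 0 ≤ A)
    {φ φ1 φ2 : ℝ → ℝ} (d1 : ∀ x ∈ Ioo (0:ℝ) 1, HasDerivAt φ (φ1 x) x)
    (d2 : ∀ x ∈ Ioo (0:ℝ) 1, HasDerivAt φ1 (φ2 x) x)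
    (b0 : ∀ x ∈ Ioo (0:ℝ) 1, |φ x| ≤ A * (ε ^ 2 + EE c₀ ε x))
    (b2 : ∀ x ∈ Ioo (0:ℝ) 1, |φ2 x| ≤ A * (1 + (ε ^ 2)⁻¹ * EE c₀ ε x))
    {x : ℝ} (hx : x ∈ Ioo (0:ℝ) 1) :
    |φ1 x| ≤ 12 * Real.exp (c₀ / 4) * A * (ε + ε⁻¹ * EE c₀ ε x) := by
  rcases le_total x (1 / 2) with h | h
  · exact interp_half hc hε hε1 hA d1 d2 b0 b2 hx.1 h
  have m : ∀ x ∈ Ioo (0:ℝ) 1, 1 - x ∈ Ioo (0:ℝ) 1 := fun x hx => ⟨by linarith [hx.2], by linarith [hx.1]⟩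
  have := interp_half (φ := fun t => φ (1 - t)) (φ1 := fun t => -φ1 (1 - t))
    (φ2 := fun t => φ2 (1 - t)) hc hε hε1 hA
    (fun x hx => (d1 _ (m x hx)).comp_const_sub 1 x)
    (fun x hx => by simpa using ((d2 _ (m x hx)).comp_const_sub 1 x).fun_neg)
    (fun x hx => by simpa [EE_reflect] using b0 _ (m x hx))
    (fun x hx => by simpa [EE_reflect] using b2 _ (m x hx)) (x := 1 - x) (by linarith [hx.2]) (by linarith)
  simpa [EE_reflect] using this

lemma barrier {c₀ ε W B : ℝ} (hc : 0 < c₀) (hε : 0 < ε) (hW : 0 < W) (hB : 0 < B)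
    {v v1 v2 : ℝ → ℝ} (hcont : ContinuousOn v (Icc 0 1))
    (d1 : ∀ x ∈ Ioo (0:ℝ) 1, HasDerivAt v (v1 x) x)
    (d2 : ∀ x ∈ Ioo (0:ℝ) 1, HasDerivAt v1 (v2 x) x)
    (h0 : v 0 ≤ B) (h1 : v 1 ≤ B)
    (hv : ∀ x ∈ Ioo (0:ℝ) 1, 0 < v x → c₀ ^ 2 * v x - ε ^ 2 * W ≤ ε ^ 2 * v2 x) :
    ∀ x ∈ Icc (0:ℝ) 1, v x ≤ W / c₀ ^ 2 * ε ^ 2 + B * EE c₀ ε x := by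
  have hEc : Continuous (EE c₀ ε) := by unfold EE; fun_prop
  by_contra hcon
  push Not at hcon
  obtain ⟨x₁, hx₁, hlt⟩ := hcon
  obtain ⟨x, hx, hmax⟩ := isCompact_Icc.exists_isMaxOn (s := Icc (0:ℝ) 1) ⟨x₁, hx₁⟩
    (f := fun t => v t - (W / c₀ ^ 2 * ε ^ 2 + B * EE c₀ ε t)) (by fun_prop)
  have hpos : 0 < v x - (W / c₀ ^ 2 * ε ^ 2 + B * EE c₀ ε x) :=
    lt_of_lt_of_le (by linarith) (hmax hx₁)
  have hW2 : 0 < W / c₀ ^ 2 * ε ^ 2 := by positivity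
  have hx0 : x ≠ 0 := by
    rintro rfl
    nlinarith [EE_zero_ge c₀ ε]
  have hx1 : x ≠ 1 := by
    rintro rfl
    nlinarith [EE_one_ge c₀ ε]
  have hxI : x ∈ Ioo (0:ℝ) 1 := ⟨lt_of_le_of_ne hx.1 (Ne.symm hx0), lt_of_le_of_ne hx.2 hx1⟩
  have hE := EE_pos c₀ ε x
  have hvpos : 0 < v x := by
    have : 0 < B * EE c₀ ε x := by positivity
    linarith
  have key := second_deriv_nonpos (z2 := v2 x - B * ((c₀ / ε) ^ 2 * EE c₀ ε x))
    (hmax.isLocalMax (Icc_mem_nhds hxI.1 hxI.2))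
    (z1 := fun t => v1 t - B * EE1 c₀ ε t)
    (by
      filter_upwards [Ioo_mem_nhds hxI.1 hxI.2] with t ht
      exact ((d1 t ht).fun_sub ((((EE_hasDerivAt c₀ ε t).const_mul B)).const_add _)))
    ((d2 x hxI).fun_sub ((EE1_hasDerivAt c₀ ε x).const_mul B))
  have k2 := hv x hxI hvpos
  have k3 : ε ^ 2 * (v2 x - B * ((c₀ / ε) ^ 2 * EE c₀ ε x)) ≤ 0 :=
    mul_nonpos_of_nonneg_of_nonpos (by positivity) key
  have k4 : ε ^ 2 * (B * ((c₀ / ε) ^ 2 * EE c₀ ε x)) = c₀ ^ 2 * (B * EE c₀ ε x) := by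
    field_simp
  have k5 : c₀ ^ 2 * (W / c₀ ^ 2 * ε ^ 2) = ε ^ 2 * W := by field_simp
  have k6 : 0 < c₀ ^ 2 * (v x - (W / c₀ ^ 2 * ε ^ 2 + B * EE c₀ ε x)) := by positivity
  nlinarith

structure Bnd (c₀ ε C : ℝ) (u2 u3 u4 : ℝ → ℝ) : Prop where
  b2 : ∀ x ∈ Ioo (0:ℝ) 1, ε ^ 2 * |u2 x| ≤ C * (ε ^ 2 + EE c₀ ε x)
  b3 : ∀ x ∈ Ioo (0:ℝ) 1, ε ^ 2 * |u3 x| ≤ C * (ε + ε⁻¹ * EE c₀ ε x)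
  b4 : ∀ x ∈ Ioo (0:ℝ) 1, ε ^ 2 * |u4 x| ≤ C * (1 + (ε ^ 2)⁻¹ * EE c₀ ε x)

lemma Bnd.reflect {c₀ ε C : ℝ} {u2 u3 u4 : ℝ → ℝ} (h : Bnd c₀ ε C u2 u3 u4) :
    Bnd c₀ ε C (fun t => u2 (1 - t)) (fun t => -u3 (1 - t)) (fun t => u4 (1 - t)) := by
  have m : ∀ x ∈ Ioo (0:ℝ) 1, 1 - x ∈ Ioo (0:ℝ) 1 := fun x hx => ⟨by linarith [hx.2], by linarith [hx.1]⟩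
  refine ⟨fun x hx => ?_, fun x hx => ?_, fun x hx => ?_⟩
  · simpa [EE_reflect] using h.b2 _ (m x hx)
  · simpa [EE_reflect] using h.b3 _ (m x hx)
  · simpa [EE_reflect] using h.b4 _ (m x hx)

section
variable {f : ℝ → ℝ → ℝ} {c₀ : ℝ} {fx fu fxx fxu fux fuu : ℝ × ℝ → ℝ}

lemma FD.chain (h : FD f c₀ fx fu fxx fxu fux fuu) {ε : ℝ} (hε : 0 < ε) {u : ℝ → ℝ}
    (hu : IsSolution f ε u) :
    ∃ u1 u2 u3 u4 : ℝ → ℝ, Chain4 u u1 u2 u3 u4 ∧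
      (∀ x ∈ Ioo (0:ℝ) 1, ε ^ 2 * u2 x = f x (u x)) ∧
      (∀ x ∈ Ioo (0:ℝ) 1, ε ^ 2 * u3 x = fx (x, u x) + fu (x, u x) * u1 x) ∧
      (∀ x ∈ Ioo (0:ℝ) 1, ε ^ 2 * u4 x = (fxx (x, u x) + fxu (x, u x) * u1 x)
        + ((fux (x, u x) + fuu (x, u x) * u1 x) * u1 x + fu (x, u x) * u2 x)) := by
  obtain ⟨hC, hode, _, _⟩ := hu
  have hcd : ∀ x ∈ Ioo (0:ℝ) 1, ContDiffAt ℝ 4 u x := fun x hx =>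
    hC.contDiffAt (Icc_mem_nhds hx.1 hx.2)
  have d1 : ∀ x ∈ Ioo (0:ℝ) 1, HasDerivAt u (deriv u x) x := fun x hx =>
    ((hcd x hx).differentiableAt (by norm_num)).hasDerivAt
  have d2 : ∀ x ∈ Ioo (0:ℝ) 1, HasDerivAt (deriv u) (f x (u x) / ε ^ 2) x := by
    intro x hx
    have e1 : iteratedDerivWithin 2 u (Icc (0:ℝ) 1) x = deriv (deriv u) x := by
      rw [iteratedDerivWithin_eq_iteratedDeriv (uniqueDiffOn_Icc (by norm_num))
        ((hcd x hx).of_le (by norm_num)) ⟨hx.1.le, hx.2.le⟩]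
      rw [iteratedDeriv_succ, iteratedDeriv_one]
    have h1 := hode x hx
    rw [e1] at h1
    have h2 : f x (u x) / ε ^ 2 = deriv (deriv u) x := by
      rw [div_eq_iff (by positivity)]; linarith
    rw [h2]
    have h3 : ContDiffOn ℝ 1 (deriv u) (Ioo 0 1) :=
      (hC.mono Ioo_subset_Icc_self).deriv_of_isOpen isOpen_Ioo (by norm_num)
    exact ((h3.contDiffAt (Ioo_mem_nhds hx.1 hx.2)).differentiableAt (by norm_num)).hasDerivAt
  have d3 : ∀ x ∈ Ioo (0:ℝ) 1, HasDerivAt (fun x => f x (u x) / ε ^ 2)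
      ((fx (x, u x) + fu (x, u x) * deriv u x) / ε ^ 2) x := fun x hx =>
    (HasFDerivAt.comp_graph (h.df x hx (u x)) (d1 x hx)).div_const _
  have d4 : ∀ x ∈ Ioo (0:ℝ) 1, HasDerivAt (fun x => (fx (x, u x) + fu (x, u x) * deriv u x) / ε ^ 2)
      (((fxx (x, u x) + fxu (x, u x) * deriv u x)
        + ((fux (x, u x) + fuu (x, u x) * deriv u x) * deriv u x
            + fu (x, u x) * (f x (u x) / ε ^ 2))) / ε ^ 2) x := fun x hx =>
    (((h.dfx x hx (u x)).comp_graph (d1 x hx)).fun_add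
      (((h.dfu x hx (u x)).comp_graph (d1 x hx)).fun_mul (d2 x hx))).div_const _
  refine ⟨_, _, _, _, ⟨hC.continuousOn, d1, d2, d3, d4⟩, ?_, ?_, ?_⟩ <;>
  · intro x hx; field_simp
end
/-! ### Uniform derivative bounds for the solution -/

section
variable {f : ℝ → ℝ → ℝ} {c₀ : ℝ} {fx fu fxx fxu fux fuu : ℝ × ℝ → ℝ}

lemma FD.lip (h : FD f c₀ fx fu fxx fxu fux fuu) {R M x : ℝ} (hx : x ∈ Ioo (0:ℝ) 1)
    (hM : ∀ y, |y| ≤ R → |fu (x, y)| ≤ M) {y y' : ℝ} (hy : |y| ≤ R) (hy' : |y'| ≤ R) :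
    |f x y - f x y'| ≤ M * |y - y'| := by
  have hd : ∀ t, HasDerivAt (f x) (fu (x, t)) t := fun t => by
    have h2 : HasDerivAt (fun t : ℝ => (x, t)) ((0:ℝ), (1:ℝ)) t :=
      (hasDerivAt_const t x).prodMk (hasDerivAt_id' t)
    exact ((h.df x hx t).comp_hasDerivAt t h2).congr_deriv (by simp)
  exact Convex.norm_image_sub_le_of_norm_hasDerivWithin_le (s := Icc (-R) R) (f := f x)
    (f' := fun t => fu (x, t)) (fun t _ => (hd t).hasDerivWithinAt)
    (fun t ht => hM t (abs_le.2 ht)) (convex_Icc _ _) (abs_le.1 hy') (abs_le.1 hy)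

set_option maxHeartbeats 2000000 in
lemma FD.bounds (h : FD f c₀ fx fu fxx fxu fux fuu) :
    ∃ C : ℝ, 0 < C ∧ ∀ ε ∈ Ioc (0:ℝ) 1, ∀ u : ℝ → ℝ, IsSolution f ε u →
      ∃ u1 u2 u3 u4 : ℝ → ℝ, Chain4 u u1 u2 u3 u4 ∧
        (∀ x ∈ Ioo (0:ℝ) 1, ε ^ 2 * u2 x = f x (u x)) ∧ Bnd c₀ ε C u2 u3 u4 := by
  have hc := h.hc
  have hc2 : 0 < c₀ ^ 2 := pow_pos h.hc 2
  obtain ⟨w, w1, w2, W, hW, hw0, hwc, hwd1, hwd2, bw, bw1, bw2⟩ := h.reduced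
  obtain ⟨C1, hC1⟩ : ∃ C1, C1 = W / c₀ ^ 2 + W := ⟨_, rfl⟩
  have hC1p : 0 < C1 := by rw [hC1]; positivity
  obtain ⟨R, hR⟩ : ∃ R, R = W + 3 * C1 := ⟨_, rfl⟩
  obtain ⟨Ax, hAx, bx⟩ := SS_bdd h.cx R
  obtain ⟨Au, hAu, bu⟩ := SS_bdd h.cu R
  obtain ⟨Axx, hAxx, bxx⟩ := SS_bdd h.cxx R
  obtain ⟨Axu, hAxu, bxu⟩ := SS_bdd h.cxu R
  obtain ⟨Aux, hAux, bux⟩ := SS_bdd h.cux R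
  obtain ⟨Auu, hAuu, buu⟩ := SS_bdd h.cuu R
  obtain ⟨M, hM⟩ : ∃ M, M = Ax + Au + Axx + Axu + Aux + Auu := ⟨_, rfl⟩
  have hMp : 0 < M := by rw [hM]; positivity
  obtain ⟨K, hK⟩ : ∃ K, K = 12 * Real.exp (c₀ / 4) := ⟨_, rfl⟩
  have hKp : 0 < K := by rw [hK]; positivity
  obtain ⟨A, hA⟩ : ∃ A, A = M * C1 + W + C1 := ⟨_, rfl⟩
  have hAp : 0 < A := by rw [hA]; positivity
  obtain ⟨P, hP⟩ : ∃ P, P = K * A + W := ⟨_, rfl⟩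
  have hPp : 0 < P := by rw [hP]; positivity
  obtain ⟨A2, hA2⟩ : ∃ A2, A2 = M + 2 * M * P + 4 * M * P ^ 2 + M * (M * C1) + M * C1 := ⟨_, rfl⟩
  have hA2p : 0 < A2 := by rw [hA2]; positivity
  refine ⟨M * C1 + K * A2 + A2, by positivity, ?_⟩
  intro ε hε u hu
  have hε0 := hε.1
  have hε1 := hε.2
  have hu0 : u 0 = 0 := hu.2.2.1
  have hu1 : u 1 = 0 := hu.2.2.2
  obtain ⟨u1, u2, u3, u4, ch, e2, e3, e4⟩ := h.chain hε0 hu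
  refine ⟨u1, u2, u3, u4, ch, e2, ?_⟩
  have hsub : ∀ x ∈ Ioo (0:ℝ) 1, x ∈ Icc (0:ℝ) 1 := fun x hx => ⟨hx.1.le, hx.2.le⟩
  have zup := barrier (c₀ := c₀) (ε := ε) (W := W) (B := W) hc hε0 hW hW
    (v := fun t => u t - w t) (v1 := fun t => u1 t - w1 t) (v2 := fun t => u2 t - w2 t)
    (ch.cont.sub hwc) (fun x hx => (ch.d1 x hx).fun_sub (hwd1 x hx))
    (fun x hx => (ch.d2 x hx).fun_sub (hwd2 x hx))
    (by have := bw 0 ⟨le_rfl, zero_le_one⟩; rw [hu0]; linarith [neg_abs_le (w 0)])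
    (by have := bw 1 ⟨zero_le_one, le_rfl⟩; rw [hu1]; linarith [neg_abs_le (w 1)])
    (by
      intro x hx hpos
      have s := h.slope x (hsub x hx) (w x) (u x) (by linarith)
      rw [hw0 x (hsub x hx)] at s
      have := e2 x hx
      have := le_abs_self (w2 x)
      have := bw2 x hx
      have : ε ^ 2 * w2 x ≤ ε ^ 2 * W := by gcongr; linarith
      linarith)
  have zlo := barrier (c₀ := c₀) (ε := ε) (W := W) (B := W) hc hε0 hW hW
    (v := fun t => w t - u t) (v1 := fun t => w1 t - u1 t) (v2 := fun t => w2 t - u2 t)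
    (hwc.sub ch.cont) (fun x hx => (hwd1 x hx).fun_sub (ch.d1 x hx))
    (fun x hx => (hwd2 x hx).fun_sub (ch.d2 x hx))
    (by have := bw 0 ⟨le_rfl, zero_le_one⟩; rw [hu0]; linarith [le_abs_self (w 0)])
    (by have := bw 1 ⟨zero_le_one, le_rfl⟩; rw [hu1]; linarith [le_abs_self (w 1)])
    (by
      intro x hx hpos
      have s := h.slope x (hsub x hx) (u x) (w x) (by linarith)
      rw [hw0 x (hsub x hx)] at s
      have := e2 x hx
      have := neg_abs_le (w2 x)
      have := bw2 x hx
      have : ε ^ 2 * (-w2 x) ≤ ε ^ 2 * W := by gcongr; linarith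
      linarith)
  have z0 : ∀ x ∈ Icc (0:ℝ) 1, |u x - w x| ≤ C1 * (ε ^ 2 + EE c₀ ε x) := by
    intro x hx
    have a1 := zup x hx
    have a2 := zlo x hx
    have hE := EE_pos c₀ ε x
    have a3 : W / c₀ ^ 2 * ε ^ 2 + W * EE c₀ ε x ≤ C1 * (ε ^ 2 + EE c₀ ε x) := by
      have : 0 ≤ W / c₀ ^ 2 * EE c₀ ε x := by positivity
      have : 0 ≤ W * ε ^ 2 := by positivity
      rw [hC1]
      linarith
    rw [abs_le]
    constructor <;> linarith
  have hε2 : ε ^ 2 ≤ 1 := pow_le_one₀ hε0.le hε1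
  have ub : ∀ x ∈ Icc (0:ℝ) 1, |u x| ≤ R := by
    intro x hx
    have a1 := z0 x hx
    have a2 := EE_le_two (c₀ := c₀) hc hε0 hx
    have a3 := bw x hx
    have a4 : C1 * (ε ^ 2 + EE c₀ ε x) ≤ C1 * 3 := by gcongr; linarith
    have a5 : u x = (u x - w x) + w x := by ring
    rw [a5]
    linarith [abs_add_le (u x - w x) (w x)]
  have wb : ∀ x ∈ Icc (0:ℝ) 1, |w x| ≤ R := fun x hx => (bw x hx).trans (by rw [hR]; linarith)
  have g0 : ∀ x ∈ Ioo (0:ℝ) 1, |f x (u x)| ≤ M * C1 * (ε ^ 2 + EE c₀ ε x) := by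
    intro x hx
    have a1 := h.lip hx (R := R) (M := M)
      (fun y hy => (bu x (hsub x hx) y hy).trans (by rw [hM]; linarith)) (ub x (hsub x hx)) (wb x (hsub x hx))
    rw [hw0 x (hsub x hx), sub_zero] at a1
    refine a1.trans ?_
    rw [mul_assoc]
    gcongr
    exact z0 x (hsub x hx)
  have inv2 : (ε ^ 2)⁻¹ * ε ^ 2 = 1 := inv_mul_cancel₀ (by positivity)
  have u2b : ∀ x ∈ Ioo (0:ℝ) 1, |u2 x| ≤ M * C1 * (1 + (ε ^ 2)⁻¹ * EE c₀ ε x) := by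
    intro x hx
    have a1 := g0 x hx
    rw [← e2 x hx, abs_mul, abs_of_pos (by positivity : 0 < ε ^ 2)] at a1
    have a2 : M * C1 * (ε ^ 2 + EE c₀ ε x) = ε ^ 2 * (M * C1 * (1 + (ε ^ 2)⁻¹ * EE c₀ ε x)) := by
      field_simp
    rw [a2] at a1
    exact le_of_mul_le_mul_left a1 (by positivity)
  have z1 : ∀ x ∈ Ioo (0:ℝ) 1, |u1 x - w1 x| ≤ K * A * (ε + ε⁻¹ * EE c₀ ε x) := by
    intro x hx
    rw [hK]
    refine interp (φ := fun t => u t - w t) (φ1 := fun t => u1 t - w1 t)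
      (φ2 := fun t => u2 t - w2 t) hc hε0 hε1 hAp.le (fun x hx => (ch.d1 x hx).fun_sub (hwd1 x hx))
      (fun x hx => (ch.d2 x hx).fun_sub (hwd2 x hx)) ?_ ?_ hx
    · intro x hx
      refine (z0 x (hsub x hx)).trans ?_
      have hE := EE_pos c₀ ε x
      gcongr
      rw [hA]; nlinarith [mul_pos hMp hC1p]
    · intro x hx
      have hE := EE_pos c₀ ε x
      have a1 := u2b x hx
      have a2 := bw2 x hx
      have a3 : 0 ≤ (ε ^ 2)⁻¹ * EE c₀ ε x := by positivity
      have a4 := abs_sub (u2 x) (w2 x)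
      rw [hA]
      nlinarith
  have u1b : ∀ x ∈ Ioo (0:ℝ) 1, |u1 x| ≤ P * (1 + ε⁻¹ * EE c₀ ε x) := by
    intro x hx
    have a1 := z1 x hx
    have a2 := bw1 x hx
    have hE := EE_pos c₀ ε x
    have a5 : u1 x = (u1 x - w1 x) + w1 x := by ring
    rw [a5]
    have a3 : 0 ≤ ε⁻¹ * EE c₀ ε x := by positivity
    have a4 : K * A * (ε + ε⁻¹ * EE c₀ ε x) ≤ K * A * (1 + ε⁻¹ * EE c₀ ε x) := by gcongr
    have a6 := abs_add_le (u1 x - w1 x) (w1 x)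
    have a7 : 0 ≤ W * (ε⁻¹ * EE c₀ ε x) := by positivity
    rw [hP]
    linarith
  have g2 : ∀ x ∈ Ioo (0:ℝ) 1, ε ^ 2 * |u4 x| ≤ A2 * (1 + (ε ^ 2)⁻¹ * EE c₀ ε x) := by
    intro x hx
    have hxI := hsub x hx
    have hE := EE_pos c₀ ε x
    have hE2 := EE_le_two (c₀ := c₀) hc hε0 hxI
    have c3 : |fxx (x, u x)| ≤ M := (bxx x hxI _ (ub x hxI)).trans (by rw [hM]; linarith)
    have c4 : |fxu (x, u x)| ≤ M := (bxu x hxI _ (ub x hxI)).trans (by rw [hM]; linarith)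
    have c5 : |fux (x, u x)| ≤ M := (bux x hxI _ (ub x hxI)).trans (by rw [hM]; linarith)
    have c6 : |fuu (x, u x)| ≤ M := (buu x hxI _ (ub x hxI)).trans (by rw [hM]; linarith)
    have c2 : |fu (x, u x)| ≤ M := (bu x hxI _ (ub x hxI)).trans (by rw [hM]; linarith)
    obtain ⟨e, he⟩ : ∃ e, e = (ε ^ 2)⁻¹ * EE c₀ ε x := ⟨_, rfl⟩
    obtain ⟨d, hd⟩ : ∃ d, d = ε⁻¹ * EE c₀ ε x := ⟨_, rfl⟩
    have hep : 0 < e := by rw [he]; positivity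
    have hdp : 0 < d := by rw [hd]; positivity
    have hde : d ≤ e := by
      have : e = ε⁻¹ * d := by rw [he, hd]; field_simp
      have h1 : 1 ≤ ε⁻¹ := (one_le_inv₀ hε0).2 hε1
      rw [this]; nlinarith
    have hd2 : d ^ 2 ≤ 2 * e := by
      have : d ^ 2 = e * EE c₀ ε x := by rw [he, hd]; field_simp
      rw [this]; nlinarith
    have b1 := u1b x hx
    have b2 := u2b x hx
    rw [← hd] at b1
    rw [← he] at b2 ⊢
    have b1' : |u1 x| ≤ P * (1 + e) := b1.trans (by gcongr)
    have b1s : |u1 x| ^ 2 ≤ 4 * P ^ 2 * (1 + e) := by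
      calc |u1 x| ^ 2 ≤ (P * (1 + d)) ^ 2 := by gcongr
        _ = P ^ 2 * (1 + 2 * d + d ^ 2) := by ring
        _ ≤ P ^ 2 * (4 * (1 + e)) := by gcongr; linarith
        _ = _ := by ring
    have q : ε ^ 2 * |u4 x| = |ε ^ 2 * u4 x| := by rw [abs_mul, abs_of_pos (by positivity : 0 < ε ^ 2)]
    rw [q, e4 x hx]
    have t1 : |fxu (x, u x) * u1 x| ≤ M * (P * (1 + e)) := by rw [abs_mul]; gcongr
    have t2 : |fux (x, u x) * u1 x| ≤ M * (P * (1 + e)) := by rw [abs_mul]; gcongr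
    have t3 : |fuu (x, u x) * u1 x * u1 x| ≤ M * (4 * P ^ 2 * (1 + e)) := by
      rw [mul_assoc, abs_mul, abs_mul, ← sq]; gcongr
    have t4 : |fu (x, u x) * u2 x| ≤ M * (M * C1 * (1 + e)) := by rw [abs_mul]; gcongr
    have s1 : |(fxx (x, u x) + fxu (x, u x) * u1 x)
        + ((fux (x, u x) + fuu (x, u x) * u1 x) * u1 x + fu (x, u x) * u2 x)|
        ≤ |fxx (x, u x)| + |fxu (x, u x) * u1 x| + (|fux (x, u x) * u1 x|
          + |fuu (x, u x) * u1 x * u1 x| + |fu (x, u x) * u2 x|) := by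
      rw [add_mul]
      refine (abs_add_le _ _).trans (add_le_add (abs_add_le _ _) ?_)
      exact (abs_add_le _ _).trans (add_le_add (abs_add_le _ _) le_rfl)
    refine s1.trans ?_
    have : 0 ≤ M * C1 * (1 + e) := by positivity
    have : 0 ≤ M * e := by positivity
    rw [hA2]
    linarith
  have gd1 : ∀ x ∈ Ioo (0:ℝ) 1, HasDerivAt (fun t => ε ^ 2 * u2 t) (ε ^ 2 * u3 x) x :=
    fun x hx => (ch.d3 x hx).const_mul _
  have gd2 : ∀ x ∈ Ioo (0:ℝ) 1, HasDerivAt (fun t => ε ^ 2 * u3 t) (ε ^ 2 * u4 x) x :=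
    fun x hx => (ch.d4 x hx).const_mul _
  have absε : ∀ r, |ε ^ 2 * r| = ε ^ 2 * |r| := fun r => by
    rw [abs_mul, abs_of_pos (by positivity : 0 < ε ^ 2)]
  have hle : M * C1 ≤ A2 := by rw [hA2]; nlinarith [mul_pos hMp hC1p, mul_pos hMp hPp, mul_pos hMp (pow_pos hPp 2), mul_pos hMp (mul_pos hMp hC1p)]
  have g0' : ∀ x ∈ Ioo (0:ℝ) 1, ε ^ 2 * |u2 x| ≤ M * C1 * (ε ^ 2 + EE c₀ ε x) := fun x hx => by
    rw [← absε, e2 x hx]; exact g0 x hx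
  have hMC : 0 < M * C1 := by positivity
  have hKA : 0 < K * A2 := by positivity
  refine ⟨fun x hx => ?_, fun x hx => ?_, fun x hx => ?_⟩
  · have hE := EE_pos c₀ ε x
    refine (g0' x hx).trans ?_
    gcongr
    linarith
  · have hE := EE_pos c₀ ε x
    rw [← absε]
    have := interp hc hε0 hε1 hA2p.le gd1 gd2 (fun x hx => by
      have hE := EE_pos c₀ ε x
      rw [absε]; refine (g0' x hx).trans ?_; gcongr) (fun x hx => by rw [absε]; exact g2 x hx) hx
    refine this.trans ?_
    rw [← hK]
    gcongr
    linarith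
  · have hE := EE_pos c₀ ε x
    refine (g2 x hx).trans ?_
    gcongr
    linarith
end
/-! ### The Bakhvalov mesh -/

def Lam (a ε q α t : ℝ) : ℝ :=
  if t ≤ α then bakhPhi a ε q t else bakhPhi a ε q α + bakhPhi' a ε q α * (t - α)

def sig (q α t : ℝ) : ℝ := q - min t α

section
variable {a ε q α : ℝ}

lemma alpha_lower (ha : 0 < a) (hε : 0 < ε) (hq : q ∈ Ioo (0:ℝ) (1/2)) (h : IsBakhAlpha a ε q α) :
    a * ε * (1 - 2 * q) ≤ q - α := by
  obtain ⟨⟨h0, h1⟩, h2⟩ := h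
  have hs : 0 < q - α := by linarith
  have hl : 0 ≤ bakhPhi a ε q α := by
    unfold bakhPhi
    have : 0 ≤ Real.log (q / (q - α)) := Real.log_nonneg (by rw [le_div_iff₀ hs]; linarith)
    positivity
  have h3 : bakhPhi' a ε q α * (1/2 - α) ≤ 1/2 := by linarith
  unfold bakhPhi' at h3
  rw [div_mul_eq_mul_div, div_le_iff₀ hs] at h3
  have : 0 < a * ε := by positivity
  nlinarith [hq.1, hq.2]

lemma alpha_upper (ha : 0 < a) (hε : 0 < ε) (hq : q ∈ Ioo (0:ℝ) (1/2)) (h : IsBakhAlpha a ε q α) :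
    q - α ≤ 2 * a * ε := by
  obtain ⟨⟨h0, h1⟩, h2⟩ := h
  have hs : 0 < q - α := by linarith
  have hq0 := hq.1
  have hl : Real.log (q / (q - α)) ≤ q / (q - α) - 1 := Real.log_le_sub_one_of_pos (by positivity)
  have hae : 0 < a * ε := by positivity
  have h3 : bakhPhi a ε q α ≤ a * ε * (q / (q - α) - 1) := by
    unfold bakhPhi; gcongr
  unfold bakhPhi' at h2
  have h4 : 1 / 2 ≤ a * ε * (q / (q - α) - 1) + a * ε / (q - α) * (1 / 2 - α) := by linarith
  have h5 : a * ε * (q / (q - α) - 1) + a * ε / (q - α) * (1 / 2 - α) = a * ε * (1/2) / (q - α) := by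
    field_simp; ring
  rw [h5, le_div_iff₀ hs] at h4
  linarith

lemma sig_ge (t : ℝ) : q - α ≤ sig q α t := by unfold sig; linarith [min_le_right t α]

lemma sig_anti {t t' : ℝ} (h : t ≤ t') : sig q α t' ≤ sig q α t := by
  unfold sig; linarith [min_le_min_right α h]

lemma sig_lip {t t' : ℝ} (h : t ≤ t') : sig q α t ≤ sig q α t' + (t' - t) := by
  unfold sig
  rcases le_total t α with h1 | h1 <;> rcases le_total t' α with h2 | h2 <;>
  simp [h1, h2] <;> linarith

lemma phi_slope (ha : 0 < a) (hε : 0 < ε) (hq : 0 < q) {t t' : ℝ} (h : t ≤ t') (h' : t' < q) :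
    a * ε / (q - t) * (t' - t) ≤ bakhPhi a ε q t' - bakhPhi a ε q t ∧
    bakhPhi a ε q t' - bakhPhi a ε q t ≤ a * ε / (q - t') * (t' - t) := by
  have h1 : 0 < q - t' := by linarith
  have h2 : 0 < q - t := by linarith
  have hae : 0 < a * ε := by positivity
  have e : bakhPhi a ε q t' - bakhPhi a ε q t = a * ε * Real.log ((q - t) / (q - t')) := by
    unfold bakhPhi
    rw [Real.log_div hq.ne' h1.ne', Real.log_div hq.ne' h2.ne', Real.log_div h2.ne' h1.ne']
    ring
  have u1 := Real.log_le_sub_one_of_pos (show 0 < (q - t) / (q - t') by positivity)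
  have u2 := Real.one_sub_inv_le_log_of_pos (show 0 < (q - t) / (q - t') by positivity)
  rw [e]
  constructor
  · calc a * ε / (q - t) * (t' - t) = a * ε * (1 - ((q - t) / (q - t'))⁻¹) := by
          field_simp; ring
      _ ≤ _ := by gcongr
  · calc _ ≤ a * ε * ((q - t) / (q - t') - 1) := by gcongr
      _ = _ := by field_simp; ring

lemma Lam_slope (ha : 0 < a) (hε : 0 < ε) (hq : 0 < q) (hα : α < q) {t t' : ℝ} (h : t ≤ t') :
    a * ε / sig q α t * (t' - t) ≤ Lam a ε q α t' - Lam a ε q α t ∧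
    Lam a ε q α t' - Lam a ε q α t ≤ a * ε / sig q α t' * (t' - t) := by
  have hae : 0 < a * ε := by positivity
  unfold Lam sig
  rcases le_or_gt t' α with h1 | h1
  · have h0 : t ≤ α := h.trans h1
    rw [if_pos h1, if_pos h0, min_eq_left h0, min_eq_left h1]
    exact phi_slope ha hε hq h (h1.trans_lt hα)
  · rw [if_neg h1.not_ge, min_eq_right h1.le]
    have hs : 0 < q - α := by linarith
    rcases le_or_gt t α with h0 | h0
    · rw [if_pos h0, min_eq_left h0]
      obtain ⟨p1, p2⟩ := phi_slope ha hε hq h0 hα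
      have h3 : a * ε / (q - t) ≤ a * ε / (q - α) := by gcongr
      have h4 : a * ε / (q - t) * (t' - α) ≤ a * ε / (q - α) * (t' - α) := by
        apply mul_le_mul_of_nonneg_right h3; linarith
      unfold bakhPhi'
      constructor <;> linarith
    · rw [if_neg h0.not_ge, min_eq_right h0.le]
      unfold bakhPhi'
      constructor <;> linarith

lemma Lam_strict (ha : 0 < a) (hε : 0 < ε) (hq : 0 < q) (hα : α < q) {t t' : ℝ} (h : t < t') :
    Lam a ε q α t < Lam a ε q α t' := by
  have h1 := (Lam_slope (a := a) (ε := ε) ha hε hq hα h.le).1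
  have hs : 0 < sig q α t := lt_of_lt_of_le (by linarith) (sig_ge t)
  have : 0 < a * ε / sig q α t * (t' - t) := mul_pos (by positivity) (by linarith)
  linarith

lemma Lam_mono (ha : 0 < a) (hε : 0 < ε) (hq : 0 < q) (hα : α < q) {t t' : ℝ} (h : t ≤ t') :
    Lam a ε q α t ≤ Lam a ε q α t' := by
  rcases h.eq_or_lt with rfl | h
  · exact le_rfl
  · exact (Lam_strict ha hε hq hα h).le

lemma Lam_zero (hα : 0 ≤ α) (hq : 0 < q) : Lam a ε q α 0 = 0 := by
  unfold Lam bakhPhi; rw [if_pos hα]; simp [hq.ne']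

lemma Lam_reflect (h : IsBakhAlpha a ε q α) {t : ℝ} (h1 : α ≤ t) (h2 : t ≤ 1 - α) :
    Lam a ε q α (1 - t) = 1 - Lam a ε q α t := by
  have e : ∀ s, α ≤ s → Lam a ε q α s = bakhPhi a ε q α + bakhPhi' a ε q α * (s - α) := by
    intro s hs
    unfold Lam
    split_ifs with hc
    · have : s = α := le_antisymm hc hs
      rw [this]; ring
    · rfl
  rw [e t h1, e (1 - t) (by linarith)]
  linarith [h.2]

lemma bakhLam_eq (hq : q ∈ Ioo (0:ℝ) (1/2)) (h : IsBakhAlpha a ε q α) {t : ℝ} (h2 : t ≤ 1 - α) :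
    bakhLam a ε q α t = Lam a ε q α t := by
  have hα : α < 1/2 := h.1.2.trans hq.2
  rcases le_or_gt t (1/2) with h1 | h1
  · unfold bakhLam Lam
    split_ifs <;> rfl
  · have e : bakhLam a ε q α t = 1 - Lam a ε q α (1 - t) := by
      unfold bakhLam Lam
      rw [if_neg (by linarith), if_neg (by linarith)]
    rw [e, Lam_reflect h (by linarith) h2]; ring

lemma bakhLam_eq' (hq : q ∈ Ioo (0:ℝ) (1/2)) (h : IsBakhAlpha a ε q α) {t : ℝ} (h2 : t ≤ 1 - α) :
    bakhLam a ε q α (1 - t) = 1 - Lam a ε q α t := by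
  have hα : α < 1/2 := h.1.2.trans hq.2
  rcases lt_or_ge t (1/2) with h1 | h1
  · unfold bakhLam Lam
    rw [if_neg (by linarith), if_neg (by linarith), sub_sub_cancel]
  · rw [bakhLam_eq hq h (by linarith), Lam_reflect h (by linarith) h2]

lemma bakhLam_strict (ha : 0 < a) (hε : 0 < ε) (hq : q ∈ Ioo (0:ℝ) (1/2)) (h : IsBakhAlpha a ε q α)
    {t t' : ℝ} (htt : t < t') : bakhLam a ε q α t < bakhLam a ε q α t' := by
  have hα : α < 1/2 := h.1.2.trans hq.2
  have hαq := h.1.2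
  rcases le_or_gt t' (1 - α) with h1 | h1
  · rw [bakhLam_eq hq h h1, bakhLam_eq hq h (by linarith)]
    exact Lam_strict ha hε hq.1 hαq htt
  · have e : bakhLam a ε q α t' = 1 - Lam a ε q α (1 - t') := by
      rw [← bakhLam_eq' hq h (by linarith), sub_sub_cancel]
    rcases le_or_gt α t with h2 | h2
    · have e' : bakhLam a ε q α t = 1 - Lam a ε q α (1 - t) := by
        rw [← bakhLam_eq' hq h (by linarith), sub_sub_cancel]
      rw [e, e']
      have := Lam_strict (a := a) (ε := ε) ha hε hq.1 hαq (show 1 - t' < 1 - t by linarith)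
      linarith
    · rw [e, bakhLam_eq hq h (by linarith)]
      have a1 := Lam_strict (a := a) (ε := ε) ha hε hq.1 hαq (show 1 - t' < 1/2 by linarith)
      have a2 := Lam_strict (a := a) (ε := ε) ha hε hq.1 hαq (show t < 1/2 by linarith)
      have a3 := Lam_reflect h (t := 1/2) hα.le (by linarith)
      norm_num at a3 a1 a2
      linarith

lemma bakhMesh_zero (hq : q ∈ Ioo (0:ℝ) (1/2)) (h : IsBakhAlpha a ε q α) (n : ℕ) :
    bakhMesh a ε q α n 0 = 0 := by
  have h1 := h.1.1
  have h2 := h.1.2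
  have h3 := hq.2
  unfold bakhMesh
  rw [Nat.cast_zero, zero_div, bakhLam_eq hq h (by linarith), Lam_zero h.1.1.le hq.1]

lemma bakhMesh_last (hq : q ∈ Ioo (0:ℝ) (1/2)) (h : IsBakhAlpha a ε q α) {n : ℕ} (hn : 1 ≤ n) :
    bakhMesh a ε q α n n = 1 := by
  have h1 := h.1.1
  have h2 := h.1.2
  have h3 := hq.2
  have hn' : (n : ℝ) ≠ 0 := by positivity
  have := bakhLam_eq' hq h (t := 0) (by linarith)
  unfold bakhMesh
  rw [div_self hn']
  rw [sub_zero, Lam_zero h.1.1.le hq.1, sub_zero] at this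
  exact this

lemma bakhMesh_strict (ha : 0 < a) (hε : 0 < ε) (hq : q ∈ Ioo (0:ℝ) (1/2)) (h : IsBakhAlpha a ε q α)
    {n : ℕ} (hn : 1 ≤ n) : StrictMono (bakhMesh a ε q α n) := by
  intro i j hij
  apply bakhLam_strict ha hε hq h
  have : (0:ℝ) < n := by positivity
  gcongr

lemma layer_decay {c₀ : ℝ} (hac : 2 ≤ a * c₀) (ha : 0 < a) (hc : 0 < c₀) (hε : 0 < ε)
    (hq : 0 < q) (hα0 : 0 < α) (hα : α < q) {t x : ℝ} (ht : 0 ≤ t) (hx : Lam a ε q α t ≤ x) :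
    Real.exp (-c₀ * x / ε) ≤ (sig q α t / q) ^ 2 := by
  have hs : 0 < sig q α t := lt_of_lt_of_le (by linarith) (sig_ge t)
  have hsq : sig q α t ≤ q := by
    unfold sig; linarith [le_min ht hα0.le]
  have h1 : a * ε * Real.log (q / sig q α t) ≤ Lam a ε q α t := by
    have m := Lam_mono (a := a) (ε := ε) ha hε hq hα (min_le_left t α)
    have : Lam a ε q α (min t α) = a * ε * Real.log (q / sig q α t) := by
      unfold Lam; rw [if_pos (min_le_right t α)]; rfl
    linarith
  have hl : 0 ≤ Real.log (q / sig q α t) := Real.log_nonneg (by rw [le_div_iff₀ hs]; linarith)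
  have h2 : -c₀ * x / ε ≤ -(2 * Real.log (q / sig q α t)) := by
    rw [div_le_iff₀ hε]
    have : c₀ * (a * ε * Real.log (q / sig q α t)) ≤ c₀ * x := by gcongr; linarith
    have h3 : 2 * (ε * Real.log (q / sig q α t)) ≤ a * c₀ * (ε * Real.log (q / sig q α t)) := by
      gcongr
    linarith
  calc Real.exp (-c₀ * x / ε) ≤ Real.exp (-(2 * Real.log (q / sig q α t))) := by gcongr
    _ = (sig q α t / q) ^ 2 := by
      rw [Real.exp_neg, two_mul, Real.exp_add, Real.exp_log (by positivity)]
      field_simp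

lemma EE_mesh {c₀ : ℝ} (hac : 2 ≤ a * c₀) (ha : 0 < a) (hc : 0 < c₀) (hε : 0 < ε)
    (hq : q ∈ Ioo (0:ℝ) (1/2)) (h : IsBakhAlpha a ε q α) {t t' x : ℝ} (ht : 0 ≤ t)
    (hx : Lam a ε q α t ≤ x) (hx' : x ≤ Lam a ε q α t') (ht' : t' ≤ 1 - α) :
    EE c₀ ε x ≤ (sig q α t / q) ^ 2 + 4 * a ^ 2 / q ^ 2 * ε ^ 2 := by
  have hα : α < 1/2 := h.1.2.trans hq.2
  have hq0 := hq.1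
  have h1 := layer_decay hac ha hc hε hq.1 h.1.1 h.1.2 ht hx
  have h2 : Lam a ε q α α ≤ 1 - x := by
    have m := Lam_mono (a := a) (ε := ε) ha hε hq.1 h.1.2 ht'
    have := Lam_reflect h (t := α) le_rfl (by linarith)
    linarith
  have h3 := layer_decay hac ha hc hε hq.1 h.1.1 h.1.2 h.1.1.le h2
  have h4 : sig q α α = q - α := by unfold sig; simp
  have h5 := alpha_upper ha hε hq h
  have hs : 0 < q - α := by linarith [h.1.2]
  have h6 : (sig q α α / q) ^ 2 ≤ 4 * a ^ 2 / q ^ 2 * ε ^ 2 := by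
    rw [h4]
    calc ((q - α) / q) ^ 2 ≤ (2 * a * ε / q) ^ 2 := by gcongr
      _ = _ := by field_simp; ring
  unfold EE
  linarith

end
/-! ### Truncation error on the Bakhvalov mesh -/

section
variable {a ε q α c₀ C : ℝ} {u u1 u2 u3 u4 : ℝ → ℝ}

def Kc (a q : ℝ) : ℝ := (1 + 4 * a ^ 2 / q ^ 2) * (1 / (a * (1 - 2 * q))) ^ 2 + 9 / q ^ 2

lemma Kc_pos (hq : q ∈ Ioo (0:ℝ) (1/2)) : 0 < Kc a q := by
  have := hq.1
  unfold Kc; positivity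

lemma trunc_core (hac : 2 ≤ a * c₀) (ha : 0 < a) (hc : 0 < c₀) (hε : 0 < ε)
    (hq : q ∈ Ioo (0:ℝ) (1/2)) (h : IsBakhAlpha a ε q α) (hC : 0 < C)
    (hu : Chain4 u u1 u2 u3 u4) (hb : Bnd c₀ ε C u2 u3 u4) {N t : ℝ} (hN : 0 < N) (ht : N ≤ t)
    (ht' : t + N ≤ 1 - α) :
    ε ^ 2 * |dd3 (Lam a ε q α (t - N)) (Lam a ε q α t) (Lam a ε q α (t + N))
      (u (Lam a ε q α (t - N))) (u (Lam a ε q α t)) (u (Lam a ε q α (t + N)))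
      - u2 (Lam a ε q α t)| ≤ (2 + 2 * a + a ^ 2) * C * Kc a q * N ^ 2 := by
  have hq0 := hq.1
  have hq1 := hq.2
  have hα0 := h.1.1
  have hαq := h.1.2
  have hK := Kc_pos (a := a) hq
  have hp : 0 ≤ Lam a ε q α (t - N) := by
    have := Lam_mono (a := a) (ε := ε) ha hε hq0 hαq (t := 0) (t' := t - N) (by linarith)
    rwa [Lam_zero hα0.le hq0] at this
  have hr : Lam a ε q α (t + N) ≤ 1 := by
    have m := Lam_mono (a := a) (ε := ε) ha hε hq0 hαq ht'
    have r := Lam_reflect h (t := α) le_rfl (by linarith)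
    have m2 := Lam_mono (a := a) (ε := ε) ha hε hq0 hαq hα0.le
    rw [Lam_zero hα0.le hq0] at m2
    linarith
  have hpx := Lam_strict (a := a) (ε := ε) ha hε hq0 hαq (t := t - N) (t' := t) (by linarith)
  have hxr := Lam_strict (a := a) (ε := ε) ha hε hq0 hαq (t := t) (t' := t + N) (by linarith)
  have hE : ∀ z ∈ Ioo (Lam a ε q α (t - N)) (Lam a ε q α (t + N)), EE c₀ ε z ≤
      (sig q α (t - N) / q) ^ 2 + 4 * a ^ 2 / q ^ 2 * ε ^ 2 := fun z hz =>
    EE_mesh hac ha hc hε hq h (by linarith) hz.1.le hz.2.le ht'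
  have k1 := (Lam_slope (a := a) (ε := ε) ha hε hq0 hαq (t := t - N) (t' := t) (by linarith)).1
  have k2 := (Lam_slope (a := a) (ε := ε) ha hε hq0 hαq (t := t - N) (t' := t) (by linarith)).2
  have k3 := (Lam_slope (a := a) (ε := ε) ha hε hq0 hαq (t := t) (t' := t + N) (by linarith)).1
  have k4 := (Lam_slope (a := a) (ε := ε) ha hε hq0 hαq (t := t) (t' := t + N) (by linarith)).2
  have s1 := sig_anti (q := q) (α := α) (t := t - N) (t' := t + N) (by linarith)
  have s2 := sig_lip (q := q) (α := α) (t := t - N) (t' := t + N) (by linarith)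
  have s3 := sig_ge (q := q) (α := α) (t + N)
  have al := alpha_lower ha hε hq h
  have hεk : ε ≤ 1 / (a * (1 - 2 * q)) * (q - α) := by
    have : 0 < a * (1 - 2 * q) := by apply mul_pos ha; linarith
    rw [div_mul_eq_mul_div, one_mul, le_div_iff₀ this]; linarith
  have hk1 : 0 < 1 / (a * (1 - 2 * q)) := by
    have : 0 < a * (1 - 2 * q) := by apply mul_pos ha; linarith
    positivity
  unfold Kc at hK ⊢
  generalize 1 / (a * (1 - 2 * q)) = κ at *
  generalize Lam a ε q α (t - N) = p at *
  generalize Lam a ε q α t = x at *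
  generalize Lam a ε q α (t + N) = r at *
  generalize sig q α (t - N) = σm at *
  generalize sig q α (t + N) = σp at *
  have hσp : 0 < σp := by linarith
  have hσm : 0 < σm := by linarith
  have hεσ : ε ≤ κ * σp := hεk.trans (by gcongr)
  obtain ⟨P, hP⟩ : ∃ P, P = 1 + 4 * a ^ 2 / q ^ 2 := ⟨_, rfl⟩
  have hP0 : 0 < P := by rw [hP]; positivity
  obtain ⟨G, hG⟩ : ∃ G, G = P * ε ^ 2 + (σm / q) ^ 2 := ⟨_, rfl⟩
  have hG0 : 0 < G := by rw [hG]; positivity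
  have hEG : ∀ z ∈ Ioo p r, ε ^ 2 + EE c₀ ε z ≤ G := by
    intro z hz; rw [hG, hP]; linarith [hE z hz]
  rw [← hP] at hK ⊢
  have m : ∀ z ∈ Ioo p r, z ∈ Ioo (0:ℝ) 1 := fun z hz => ⟨by linarith [hz.1], by linarith [hz.2]⟩
  rcases lt_or_ge σp N with hlt | hge
  · have hM : ∀ z ∈ Ioo p r, |u2 z| ≤ C * G / ε ^ 2 := by
      intro z hz
      rw [le_div_iff₀ (by positivity), mul_comm]
      refine (hb.b2 z (m z hz)).trans ?_
      have := hEG z hz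
      gcongr
    have := hu.dd_le hp hpx hxr hr hM
    have hGN : G ≤ (P * κ ^ 2 + 9 / q ^ 2) * N ^ 2 := by
      have e1 : ε ≤ κ * N := hεσ.trans (by gcongr)
      have e2 : σm ≤ 3 * N := by linarith
      calc G ≤ P * (κ * N) ^ 2 + (3 * N / q) ^ 2 := by rw [hG]; gcongr
        _ = _ := by field_simp; ring
    calc ε ^ 2 * |dd3 p x r (u p) (u x) (u r) - u2 x| ≤ ε ^ 2 * (2 * (C * G / ε ^ 2)) := by gcongr
      _ = 2 * C * G := by field_simp
      _ ≤ 2 * C * ((P * κ ^ 2 + 9 / q ^ 2) * N ^ 2) := by gcongr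
      _ ≤ (2 + 2 * a + a ^ 2) * C * ((P * κ ^ 2 + 9 / q ^ 2) * N ^ 2) := by
        gcongr; nlinarith
      _ = _ := by ring
  · have hM : ∀ z ∈ Ioo p r, |u4 z| ≤ C * G / ε ^ 4 := by
      intro z hz
      rw [le_div_iff₀ (by positivity)]
      have h1 := hb.b4 z (m z hz)
      have h2 := hEG z hz
      calc |u4 z| * ε ^ 4 = ε ^ 2 * (ε ^ 2 * |u4 z|) := by ring
        _ ≤ ε ^ 2 * (C * (1 + (ε ^ 2)⁻¹ * EE c₀ ε z)) := by gcongr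
        _ = C * (ε ^ 2 + EE c₀ ε z) := by field_simp
        _ ≤ C * G := by gcongr
    have h3 : |u3 x| ≤ C * G / ε ^ 3 := by
      rw [le_div_iff₀ (by positivity)]
      have h1 := hb.b3 x (m x ⟨hpx, hxr⟩)
      have h2 := hEG x ⟨hpx, hxr⟩
      calc |u3 x| * ε ^ 3 = ε * (ε ^ 2 * |u3 x|) := by ring
        _ ≤ ε * (C * (ε + ε⁻¹ * EE c₀ ε x)) := by gcongr
        _ = C * (ε ^ 2 + EE c₀ ε x) := by field_simp
        _ ≤ C * G := by gcongr
    have hhk : x - p ≤ r - x := by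
      have : t - (t - N) = t + N - t := by ring
      rw [this] at k2
      exact k2.trans k3
    have := hu.dd_le4 hp hpx hxr hr hhk hM
    have hGN : G ≤ (P * κ ^ 2 + 9 / q ^ 2) * σp ^ 2 := by
      have e2 : σm ≤ 3 * σp := by linarith
      calc G ≤ P * (κ * σp) ^ 2 + (3 * σp / q) ^ 2 := by rw [hG]; gcongr
        _ = _ := by field_simp; ring
    have hk : r - x ≤ a * ε * N / σp := by
      refine k4.trans (le_of_eq ?_); ring
    have hkh : (r - x) - (x - p) ≤ 2 * a * ε * N ^ 2 / σp ^ 2 := by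
      have e1 : a * ε * N / σm ≤ x - p := by
        refine le_trans (le_of_eq ?_) k1; ring
      calc (r - x) - (x - p) ≤ a * ε * N / σp - a * ε * N / σm := by linarith
        _ = a * ε * N * (σm - σp) / (σm * σp) := by field_simp
        _ ≤ a * ε * N * (2 * N) / (σp * σp) := by gcongr; linarith
        _ = _ := by ring
    have hrx : 0 ≤ r - x := by linarith
    calc ε ^ 2 * |dd3 p x r (u p) (u x) (u r) - u2 x|
        ≤ ε ^ 2 * (((r - x) - (x - p)) * |u3 x| + (r - x) ^ 2 * (C * G / ε ^ 4)) := by gcongr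
      _ ≤ ε ^ 2 * (2 * a * ε * N ^ 2 / σp ^ 2 * (C * G / ε ^ 3)
          + (a * ε * N / σp) ^ 2 * (C * G / ε ^ 4)) := by gcongr
      _ = (2 * a + a ^ 2) * C * N ^ 2 * (G / σp ^ 2) := by field_simp
      _ ≤ (2 * a + a ^ 2) * C * N ^ 2 * (P * κ ^ 2 + 9 / q ^ 2) := by
        gcongr
        rw [div_le_iff₀ (by positivity)]; exact hGN
      _ ≤ (2 + 2 * a + a ^ 2) * C * N ^ 2 * (P * κ ^ 2 + 9 / q ^ 2) := by gcongr; linarith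
      _ = _ := by ring

lemma dd3_symm (p x r up ux ur : ℝ) : dd3 p x r up ux ur = dd3 (1 - r) (1 - x) (1 - p) ur ux up := by
  unfold dd3
  have e1 : 1 - p - (1 - r) = r - p := by ring
  have e2 : 1 - p - (1 - x) = x - p := by ring
  have e3 : 1 - x - (1 - r) = r - x := by ring
  rw [e1, e2, e3, ← neg_sub ur ux, ← neg_sub ux up]
  ring

lemma trunc_mesh (hac : 2 ≤ a * c₀) (ha : 0 < a) (hc : 0 < c₀) (hε : 0 < ε) (hε1 : ε ≤ 1)
    (hq : q ∈ Ioo (0:ℝ) (1/2)) (h : IsBakhAlpha a ε q α) (hC : 0 < C)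
    (hu : Chain4 u u1 u2 u3 u4) (hb : Bnd c₀ ε C u2 u3 u4) {n i : ℕ} (hi : 1 ≤ i) (hin : i < n) :
    ε ^ 2 * |ddiff (bakhMesh a ε q α n) (fun j => u (bakhMesh a ε q α n j)) i
      - u2 (bakhMesh a ε q α n i)| ≤
      ((2 + 2 * a + a ^ 2) * C * Kc a q + 6 * C / (1/2 - q) ^ 2) * ((n:ℝ) ^ 2)⁻¹ := by
  have hq0 := hq.1
  have hq1 := hq.2
  have hα0 := h.1.1
  have hαq := h.1.2
  have hK := Kc_pos (a := a) hq
  have hδ : 0 < 1/2 - q := by linarith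
  have hn : (0:ℝ) < n := by exact_mod_cast (by omega : 0 < n)
  obtain ⟨N, hN⟩ : ∃ N : ℝ, N = 1 / n := ⟨_, rfl⟩
  have hN0 : 0 < N := by rw [hN]; positivity
  have hN2 : ((n:ℝ) ^ 2)⁻¹ = N ^ 2 := by rw [hN]; field_simp
  obtain ⟨t, ht⟩ : ∃ t : ℝ, t = i / n := ⟨_, rfl⟩
  have htm : ((i - 1 : ℕ) : ℝ) / n = t - N := by
    rw [ht, hN]; push_cast [Nat.cast_sub hi]; ring
  have htp : ((i + 1 : ℕ) : ℝ) / n = t + N := by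
    rw [ht, hN]; push_cast; ring
  have hNt : N ≤ t := by
    rw [ht, hN]; gcongr; exact_mod_cast hi
  have htN : t + N ≤ 1 := by
    rw [← htp, div_le_one hn]; exact_mod_cast hin
  have key : ddiff (bakhMesh a ε q α n) (fun j => u (bakhMesh a ε q α n j)) i =
      dd3 (bakhLam a ε q α (t - N)) (bakhLam a ε q α t) (bakhLam a ε q α (t + N))
        (u (bakhLam a ε q α (t - N))) (u (bakhLam a ε q α t)) (u (bakhLam a ε q α (t + N))) := by
    unfold ddiff dd3 bakhMesh
    beta_reduce
    rw [htm, htp, ← ht]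
  have key2 : bakhMesh a ε q α n i = bakhLam a ε q α t := by unfold bakhMesh; rw [ht]
  rw [key, key2, hN2]
  have hA : 0 ≤ (2 + 2 * a + a ^ 2) * C * Kc a q := by positivity
  have hB : 0 ≤ 6 * C / (1/2 - q) ^ 2 := by positivity
  rcases lt_or_ge (1/2 - q) N with hbig | hsmall
  · have hp : 0 ≤ bakhLam a ε q α (t - N) := by
      rw [← htm]
      have := (bakhMesh_strict ha hε hq h (n := n) (by omega)).monotone (Nat.zero_le (i - 1))
      rwa [bakhMesh_zero hq h] at this
    have hr : bakhLam a ε q α (t + N) ≤ 1 := by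
      rw [← htp]
      have := (bakhMesh_strict ha hε hq h (n := n) (by omega)).monotone (show i + 1 ≤ n by omega)
      rwa [bakhMesh_last hq h (by omega)] at this
    have hpx := bakhLam_strict ha hε hq h (show t - N < t by linarith)
    have hxr := bakhLam_strict ha hε hq h (show t < t + N by linarith)
    have := hu.dd_le hp hpx hxr hr (M := 3 * C / ε ^ 2) (by
      intro z hz
      have hz' : z ∈ Ioo (0:ℝ) 1 := ⟨by linarith [hz.1], by linarith [hz.2]⟩
      rw [le_div_iff₀ (by positivity), mul_comm]
      refine (hb.b2 z hz').trans ?_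
      have h1 := EE_le_two hc hε (Ioo_subset_Icc_self hz')
      have h2 : ε ^ 2 ≤ 1 := pow_le_one₀ hε.le hε1
      nlinarith)
    calc _ ≤ ε ^ 2 * (2 * (3 * C / ε ^ 2)) := by gcongr
      _ = 6 * C := by field_simp; norm_num
      _ = 6 * C / (1/2 - q) ^ 2 * (1/2 - q) ^ 2 := (div_mul_cancel₀ _ (by positivity)).symm
      _ ≤ 6 * C / (1/2 - q) ^ 2 * N ^ 2 := by gcongr
      _ ≤ _ := by gcongr; linarith
  · refine le_trans ?_ (mul_le_mul_of_nonneg_right (le_add_of_nonneg_right hB) (by positivity))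
    rcases le_total t (1/2) with h2 | h2
    · rw [bakhLam_eq hq h (t := t - N) (by linarith), bakhLam_eq hq h (t := t) (by linarith),
        bakhLam_eq hq h (t := t + N) (by linarith)]
      exact trunc_core hac ha hc hε hq h hC hu hb hN0 hNt (by linarith)
    · have := trunc_core hac ha hc hε hq h hC hu.reflect hb.reflect hN0 (t := 1 - t) (by linarith)
        (by linarith)
      have e1 : bakhLam a ε q α (t - N) = 1 - Lam a ε q α (1 - t + N) := by
        rw [← bakhLam_eq' hq h (by linarith)]; congr 1; ring
      have e2 : bakhLam a ε q α t = 1 - Lam a ε q α (1 - t) := by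
        rw [← bakhLam_eq' hq h (by linarith)]; congr 1; ring
      have e3 : bakhLam a ε q α (t + N) = 1 - Lam a ε q α (1 - t - N) := by
        rw [← bakhLam_eq' hq h (by linarith)]; congr 1; ring
      rw [dd3_symm, e1, e2, e3]
      simpa using this

end
/-! ### The discrete problem -/

lemma ddiff_sub (x y w : ℕ → ℝ) (i : ℕ) :
    ddiff x y i - ddiff x w i = ddiff x (fun j => y j - w j) i := by
  unfold ddiff; ring

lemma ddiff_nonpos {x e : ℕ → ℝ} (hx : StrictMono x) {i : ℕ} (hi : 1 ≤ i) (h1 : e (i - 1) ≤ e i)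
    (h2 : e (i + 1) ≤ e i) : ddiff x e i ≤ 0 := by
  unfold ddiff
  have a1 : x (i - 1) < x i := hx (by omega)
  have a2 : x i < x (i + 1) := hx (by omega)
  apply mul_nonpos_of_nonneg_of_nonpos
  · apply div_nonneg (by norm_num); linarith
  · have b1 : (e (i + 1) - e i) / (x (i + 1) - x i) ≤ 0 :=
      div_nonpos_of_nonpos_of_nonneg (by linarith) (by linarith)
    have b2 : 0 ≤ (e i - e (i - 1)) / (x i - x (i - 1)) :=
      div_nonneg (by linarith) (by linarith)
    linarith

section
variable {f : ℝ → ℝ → ℝ} {c₀ : ℝ} {fx fu fxx fxu fux fuu : ℝ × ℝ → ℝ}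

lemma FD.stab (h : FD f c₀ fx fu fxx fxu fux fuu) {x y w : ℕ → ℝ} {n : ℕ} {ε B : ℝ}
    (hx : StrictMono x) (hxI : ∀ i ≤ n, x i ∈ Icc (0:ℝ) 1) (hB : 0 ≤ B)
    (h0 : y 0 = w 0) (hn : y n = w n)
    (hT : ∀ i, 1 ≤ i → i < n → (-ε ^ 2 * ddiff x y i + f (x i) (y i)) -
      (-ε ^ 2 * ddiff x w i + f (x i) (w i)) ≤ B) :
    ∀ i ≤ n, c₀ ^ 2 * (y i - w i) ≤ B := by
  obtain ⟨j, hj, hm⟩ := Finset.exists_max_image (Finset.range (n + 1)) (fun j => y j - w j)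
    ⟨0, by simp⟩
  have hj' : j ≤ n := by simpa [Nat.lt_succ_iff] using hj
  have hm' : ∀ i ≤ n, y i - w i ≤ y j - w j := fun i hi => hm i (by simp; omega)
  have hc2 : 0 ≤ c₀ ^ 2 := by positivity
  suffices hs : c₀ ^ 2 * (y j - w j) ≤ B by
    intro i hi
    exact (mul_le_mul_of_nonneg_left (hm' i hi) hc2).trans hs
  rcases le_or_gt (y j - w j) 0 with hle | hpos
  · exact (mul_nonpos_of_nonneg_of_nonpos hc2 hle).trans hB
  have hj0 : j ≠ 0 := by rintro rfl; rw [h0] at hpos; simp at hpos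
  have hjn : j ≠ n := by rintro rfl; rw [hn] at hpos; simp at hpos
  have h1 : 1 ≤ j := by omega
  have h2 : j < n := by omega
  have hd := ddiff_nonpos (e := fun i => y i - w i) hx h1 (hm' _ (by omega)) (hm' _ (by omega))
  rw [← ddiff_sub] at hd
  have hs := h.slope (x j) (hxI j hj') (w j) (y j) (by linarith)
  have := hT j h1 h2
  nlinarith [mul_nonpos_of_nonneg_of_nonpos (sq_nonneg ε) hd]

lemma FD.stab_abs (h : FD f c₀ fx fu fxx fxu fux fuu) {x y w : ℕ → ℝ} {n : ℕ} {ε B : ℝ}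
    (hx : StrictMono x) (hxI : ∀ i ≤ n, x i ∈ Icc (0:ℝ) 1) (hB : 0 ≤ B)
    (h0 : y 0 = w 0) (hn : y n = w n)
    (hT : ∀ i, 1 ≤ i → i < n → |(-ε ^ 2 * ddiff x y i + f (x i) (y i)) -
      (-ε ^ 2 * ddiff x w i + f (x i) (w i))| ≤ B) :
    ∀ i ≤ n, c₀ ^ 2 * |y i - w i| ≤ B := by
  intro i hi
  have a1 := h.stab hx hxI hB h0 hn (fun i h1 h2 => (abs_le.1 (hT i h1 h2)).2) i hi
  have a2 := h.stab (ε := ε) hx hxI hB h0.symm hn.symm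
    (fun i h1 h2 => by linarith [(abs_le.1 (hT i h1 h2)).1]) i hi
  rcases abs_choice (y i - w i) with e | e <;> rw [e] <;> linarith

def shoot (f : ℝ → ℝ → ℝ) (ε : ℝ) (x : ℕ → ℝ) (s : ℝ) : ℕ → ℝ × ℝ
  | 0 => (0, s)
  | k + 1 => ((shoot f ε x s k).2, (shoot f ε x s k).2 + (x (k + 2) - x (k + 1)) *
      (((shoot f ε x s k).2 - (shoot f ε x s k).1) / (x (k + 1) - x k) +
        (x (k + 2) - x k) / 2 * (f (x (k + 1)) (shoot f ε x s k).2 / ε ^ 2)))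

lemma FD.shoot_cont (h : FD f c₀ fx fu fxx fxu fux fuu) {x : ℕ → ℝ} {n : ℕ} {ε : ℝ}
    (hxI : ∀ i ≤ n, x i ∈ Icc (0:ℝ) 1) : ∀ k < n, Continuous (fun s => shoot f ε x s k) := by
  intro k
  induction k with
  | zero => intro _; simp only [shoot]; fun_prop
  | succ k ih =>
    intro hk
    have i1 := ih (by omega)
    have i2 := h.contu (x (k + 1)) (hxI _ (by omega))
    simp only [shoot]
    have i3 : Continuous (fun s => f (x (k + 1)) (shoot f ε x s k).2) :=
      i2.comp (continuous_snd.comp i1)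
    fun_prop

lemma FD.shoot_mono (h : FD f c₀ fx fu fxx fxu fux fuu) {x : ℕ → ℝ} {n : ℕ} {ε : ℝ} (hε : 0 < ε)
    (hx : StrictMono x) (hxI : ∀ i ≤ n, x i ∈ Icc (0:ℝ) 1) {s s' : ℝ} (hs : s' ≤ s) :
    ∀ k < n, 0 ≤ (shoot f ε x s k).1 - (shoot f ε x s' k).1 ∧
      (s - s') / (x 1 - x 0) ≤ (((shoot f ε x s k).2 - (shoot f ε x s' k).2) -
        ((shoot f ε x s k).1 - (shoot f ε x s' k).1)) / (x (k + 1) - x k) := by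
  intro k
  have hx01 : 0 < x 1 - x 0 := by linarith [hx (show 0 < 1 by norm_num)]
  have hc : 0 ≤ (s - s') / (x 1 - x 0) := div_nonneg (by linarith) hx01.le
  induction k with
  | zero => intro _; simp [shoot]
  | succ k ih =>
    intro hk
    obtain ⟨i1, i2⟩ := ih (by omega)
    have hk1 : 0 < x (k + 1) - x k := by linarith [hx (show k < k + 1 by omega)]
    have hk2 : 0 < x (k + 2) - x (k + 1) := by linarith [hx (show k + 1 < k + 2 by omega)]
    simp only [shoot]
    generalize shoot f ε x s k = A at *
    generalize shoot f ε x s' k = A' at *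
    have i3 : 0 ≤ A.2 - A'.2 := by
      have : 0 ≤ A.2 - A'.2 - (A.1 - A'.1) := by
        by_contra hneg
        push Not at hneg
        have := div_neg_of_neg_of_pos hneg hk1
        linarith
      linarith
    refine ⟨i3, ?_⟩
    have hsl := h.slope (x (k + 1)) (hxI _ (by omega)) A'.2 A.2 (by linarith)
    have hf : 0 ≤ f (x (k + 1)) A.2 - f (x (k + 1)) A'.2 := by
      have : 0 ≤ c₀ ^ 2 * (A.2 - A'.2) := by positivity
      linarith
    rw [le_div_iff₀ hk2]
    have hpos : 0 ≤ (x (k + 2) - x k) / 2 * ((f (x (k + 1)) A.2 - f (x (k + 1)) A'.2) / ε ^ 2) := by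
      have : 0 ≤ x (k + 2) - x k := by linarith
      positivity
    have : (s - s') / (x 1 - x 0) * (x (k + 2) - x (k + 1)) ≤
      ((A.2 - A'.2 - (A.1 - A'.1)) / (x (k + 1) - x k) +
       (x (k + 2) - x k) / 2 * ((f (x (k + 1)) A.2 - f (x (k + 1)) A'.2) / ε ^ 2)) *
        (x (k + 2) - x (k + 1)) := by
      gcongr; linarith
    refine this.trans (le_of_eq ?_)
    show _ = _
    have e : k + 1 + 1 = k + 2 := rfl
    ring

lemma FD.exists_scheme (h : FD f c₀ fx fu fxx fxu fux fuu) {x : ℕ → ℝ} {n : ℕ} {ε : ℝ} (hε : 0 < ε)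
    (hx : StrictMono x) (hxI : ∀ i ≤ n, x i ∈ Icc (0:ℝ) 1) (hn : 2 ≤ n) :
    ∃ y : ℕ → ℝ, NonlinScheme f ε x n y := by
  obtain ⟨m, rfl⟩ : ∃ m, n = m + 1 := ⟨n - 1, by omega⟩
  have hx01 : 0 < x 1 - x 0 := by linarith [hx (show 0 < 1 by norm_num)]
  have hm : 0 < x (m + 1) - x m := by linarith [hx (show m < m + 1 by omega)]
  have hcont : Continuous (fun s => (shoot f ε x s m).2) :=
    continuous_snd.comp (h.shoot_cont hxI m (by omega))
  obtain ⟨c, hc⟩ : ∃ c, c = (x (m + 1) - x m) / (x 1 - x 0) := ⟨_, rfl⟩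
  have hc0 : 0 < c := by rw [hc]; positivity
  have hmono : ∀ s s', s' ≤ s → c * (s - s') ≤ (shoot f ε x s m).2 - (shoot f ε x s' m).2 := by
    intro s s' hs
    obtain ⟨a1, a2⟩ := h.shoot_mono hε hx hxI hs m (by omega)
    rw [le_div_iff₀ hm] at a2
    have : c * (s - s') = (s - s') / (x 1 - x 0) * (x (m + 1) - x m) := by rw [hc]; ring
    linarith
  obtain ⟨s, hs⟩ : ∃ s, (shoot f ε x s m).2 = 0 := by
    apply mem_range_of_exists_le_of_exists_ge hcont
    · obtain ⟨g, hg⟩ : ∃ g, g = (shoot f ε x 0 m).2 := ⟨_, rfl⟩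
      refine ⟨-|g| / c, ?_⟩
      have := hmono 0 (-|g| / c) (div_nonpos_of_nonpos_of_nonneg (by simp) hc0.le)
      have e : c * (0 - -|g| / c) = |g| := by field_simp; ring
      rw [e, ← hg] at this
      linarith [le_abs_self g]
    · obtain ⟨g, hg⟩ : ∃ g, g = (shoot f ε x 0 m).2 := ⟨_, rfl⟩
      refine ⟨|g| / c, ?_⟩
      have := hmono (|g| / c) 0 (by positivity)
      have e : c * (|g| / c - 0) = |g| := by field_simp; ring
      rw [e, ← hg] at this
      linarith [neg_abs_le g]
  refine ⟨fun k => (shoot f ε x s k).1, ?_, rfl, hs⟩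
  intro i h1 h2
  obtain ⟨k, rfl⟩ : ∃ k, i = k + 1 := ⟨i - 1, by omega⟩
  have hk1 : 0 < x (k + 1) - x k := by linarith [hx (show k < k + 1 by omega)]
  have hk2 : 0 < x (k + 2) - x (k + 1) := by linarith [hx (show k + 1 < k + 2 by omega)]
  have hk3 : 0 < x (k + 2) - x k := by linarith
  unfold ddiff
  rw [Nat.add_sub_cancel]
  simp only [shoot]
  generalize shoot f ε x s k = A at *
  rw [add_sub_cancel_left]
  change -ε ^ 2 * (2 / (x (k + 2) - x k) * ((x (k + 2) - x (k + 1)) * _ / (x (k + 2) - x (k + 1)) - _)) + _ = 0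
  rw [mul_div_cancel_left₀ _ hk2.ne', add_sub_cancel_left]
  generalize f (x (k + 1)) A.2 = F
  field_simp
  ring

end
/-- the nonlinear discrete scheme on the Bakhvalov mesh has a
unique solution and converges ε-uniformly with order two. -/
theorem stmt_14 (f : ℝ → ℝ → ℝ) (c₀ : ℝ) (hc₀ : 0 < c₀)
    (hf : SmoothF f) (hfu : LowerF f c₀)
    (q a : ℝ) (hq : q ∈ Ioo (0:ℝ) (1/2)) (ha : 0 < a)
    (hac : 2 ≤ a * c₀) :
    ∃ C : ℝ, 0 < C ∧
      ∀ ε ∈ Ioc (0:ℝ) 1, a * ε < q → ∀ n : ℕ, 2 ≤ n →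
      ∀ α : ℝ, IsBakhAlpha a ε q α →
      ∀ u : ℝ → ℝ, IsSolution f ε u →
        (∃ y : ℕ → ℝ, NonlinScheme f ε (bakhMesh a ε q α n) n y) ∧
        (∀ y y' : ℕ → ℝ,
          NonlinScheme f ε (bakhMesh a ε q α n) n y →
          NonlinScheme f ε (bakhMesh a ε q α n) n y' →
          ∀ i ≤ n, y i = y' i) ∧
        (∀ y : ℕ → ℝ,
          NonlinScheme f ε (bakhMesh a ε q α n) n y →
          ∀ i ≤ n,
            |u (bakhMesh a ε q α n i) - y i| ≤ C * ((n:ℝ) ^ 2)⁻¹) := by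
  obtain ⟨fx, fu, fxx, fxu, fux, fuu, h⟩ := FD.exists hc₀ hf hfu
  obtain ⟨C, hC, hbd⟩ := h.bounds
  have hK := Kc_pos (a := a) hq
  have hδ : 0 < 1/2 - q := by linarith [hq.2]
  obtain ⟨D, hD⟩ : ∃ D, D = (2 + 2 * a + a ^ 2) * C * Kc a q + 6 * C / (1/2 - q) ^ 2 := ⟨_, rfl⟩
  have hD0 : 0 < D := by rw [hD]; positivity
  refine ⟨D / c₀ ^ 2, by positivity, ?_⟩
  intro ε hε _ n hn α hα u hu
  obtain ⟨hε0, hε1⟩ := hε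
  obtain ⟨u1, u2, u3, u4, hch, heq, hb⟩ := hbd ε ⟨hε0, hε1⟩ u hu
  have hx := bakhMesh_strict ha hε0 hq hα (n := n) (by omega)
  have hx0 := bakhMesh_zero hq hα n
  have hx1 := bakhMesh_last hq hα (n := n) (by omega)
  have hxI : ∀ i ≤ n, bakhMesh a ε q α n i ∈ Icc (0:ℝ) 1 := by
    intro i hi
    refine ⟨?_, ?_⟩
    · rw [← hx0]; exact hx.monotone (Nat.zero_le i)
    · rw [← hx1]; exact hx.monotone hi
  refine ⟨h.exists_scheme hε0 hx hxI hn, ?_, ?_⟩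
  · intro y y' hy hy' i hi
    have := h.stab_abs (ε := ε) hx hxI le_rfl (hy.2.1.trans hy'.2.1.symm)
      (hy.2.2.trans hy'.2.2.symm)
      (fun i h1 h2 => by rw [hy.1 i h1 h2, hy'.1 i h1 h2]; simp) i hi
    have h2 : |y i - y' i| ≤ 0 := by
      by_contra hneg
      push Not at hneg
      have : 0 < c₀ ^ 2 * |y i - y' i| := by positivity
      linarith
    exact sub_eq_zero.1 (abs_nonpos_iff.1 h2)
  · intro y hy i hi
    have := h.stab_abs (ε := ε) (y := fun j => u (bakhMesh a ε q α n j)) (w := y)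
      (B := D * ((n:ℝ) ^ 2)⁻¹) hx hxI (by positivity)
      (by rw [hx0, hu.2.2.1, hy.2.1]) (by rw [hx1, hu.2.2.2, hy.2.2])
      (fun i h1 h2 => by
        have hT := trunc_mesh hac ha hc₀ hε0 hε1 hq hα hC hch hb h1 h2
        rw [← hD] at hT
        have hxi : bakhMesh a ε q α n i ∈ Ioo (0:ℝ) 1 := by
          refine ⟨?_, ?_⟩
          · rw [← hx0]; exact hx (by omega)
          · rw [← hx1]; exact hx h2
        rw [hy.1 i h1 h2, sub_zero]
        refine le_trans (le_of_eq ?_) hT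
        rw [← heq _ hxi]
        rw [show ε ^ 2 = |ε ^ 2| from (abs_of_nonneg (by positivity)).symm, ← abs_mul, ← abs_neg]
        congr 1
        rw [abs_of_nonneg (by positivity : 0 ≤ ε ^ 2)]
        ring) i hi
    rw [div_mul_eq_mul_div, le_div_iff₀ (by positivity), mul_comm]
    exact this
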